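/- Under the hypothesis of Theorem 1.1 — G a connected bounded-degree graph with p_n(x,x) ≤ c n^{−d/2} for some d > 4 — there exists p < 1 such that P_p(S ↮ ∞) ≤ exp(−cap(S)/2) for every finite S ⊂ V, where cap(S) = Σ_{x∈S} d(x)·P_x[X_k ∉ S ∀k ≥ 1] and P_p is Bernoulli bond percolation with parameter p. In particular, since cap({x}) > 0 for transient G, the critical parameter p_c(G) < 1. -/

import Mathlib

open MeasureTheory

open Matrix in
theorem card_factorial_mul_det_sum_vecMulVec {ι κ : Type*} [Fintype ι] [DecidableEq ι]
    (A : Finset κ) (b : κ → ι → ℝ) :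
    ((Fintype.card ι).factorial : ℝ) * (∑ j ∈ A, vecMulVec (b j) (b j)).det =
      ∑ φ ∈ Fintype.piFinset (fun _ : ι => A), (of fun i => b (φ i)).det ^ 2 := by
  classical
  have hexp : (∑ j ∈ A, vecMulVec (b j) (b j)).det =
      ∑ φ ∈ Fintype.piFinset (fun _ : ι => A),
        (∏ i, b (φ i) i) * (of fun i => b (φ i)).det := by
    have h1 : (∑ j ∈ A, vecMulVec (b j) (b j)) = fun i => ∑ j ∈ A, b j i • b j := by
      ext i k
      simp [Matrix.sum_apply, vecMulVec_apply]
    rw [h1]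
    change (detRowAlternating : (ι → ℝ) [⋀^ι]→ₗ[ℝ] ℝ).toMultilinearMap _ = _
    rw [MultilinearMap.map_sum_finset]
    refine Finset.sum_congr rfl fun φ _ => ?_
    rw [MultilinearMap.map_smul_univ]
    rfl
  have hperm : ∀ σ : Equiv.Perm ι, (∑ j ∈ A, vecMulVec (b j) (b j)).det =
      ∑ φ ∈ Fintype.piFinset (fun _ : ι => A),
        (∏ i, b (φ (σ i)) i) * ((Equiv.Perm.sign σ : ℤ) * (of fun i => b (φ i)).det) := by
    intro σ
    rw [hexp]
    refine Finset.sum_nbij' (fun φ => φ ∘ σ.symm) (fun φ => φ ∘ σ) ?_ ?_ ?_ ?_ ?_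
    · intro φ hφ
      simp only [Fintype.mem_piFinset] at hφ ⊢
      exact fun i => hφ _
    · intro φ hφ
      simp only [Fintype.mem_piFinset] at hφ ⊢
      exact fun i => hφ _
    · intro φ _
      ext i
      simp
    · intro φ _
      ext i
      simp
    · intro φ _
      have := det_permute σ (of fun i => b (φ (σ.symm i)))
      simp only [Function.comp, Equiv.symm_apply_apply]
      rw [← this]
      simp [submatrix]
  have hsum : ((Fintype.card ι).factorial : ℝ) * (∑ j ∈ A, vecMulVec (b j) (b j)).det =
      ∑ σ : Equiv.Perm ι, ∑ φ ∈ Fintype.piFinset (fun _ : ι => A),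
        (∏ i, b (φ (σ i)) i) * ((Equiv.Perm.sign σ : ℤ) * (of fun i => b (φ i)).det) := by
    rw [Finset.sum_congr rfl fun σ _ => (hperm σ).symm]
    simp [Fintype.card_perm]
  rw [hsum, Finset.sum_comm]
  refine Finset.sum_congr rfl fun φ _ => ?_
  rw [pow_two]
  nth_rw 2 [det_apply']
  rw [Finset.sum_mul]
  refine Finset.sum_congr rfl fun σ _ => ?_
  simp only [of_apply]
  ring

open Matrix in
theorem sum_det_sum_vecMulVec_le {ι κ α : Type*} [Fintype ι] [DecidableEq ι]
    (b : κ → ι → ℝ) (J : Finset κ) (s : Finset α) (A : α → Finset κ)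
    (hA : ∀ k ∈ s, A k ⊆ J)
    (hsep : ∀ k ∈ s, ∀ l ∈ s, k ≠ l →
      ∃ v : ι → ℝ, v ≠ 0 ∧ ∀ j, j ∈ A k → j ∈ A l → b j ⬝ᵥ v = 0) :
    ∑ k ∈ s, (∑ j ∈ A k, vecMulVec (b j) (b j)).det ≤
      (∑ j ∈ J, vecMulVec (b j) (b j)).det := by
  classical
  have h2 : (0 : ℝ) < (Fintype.card ι).factorial := by exact_mod_cast Nat.factorial_pos _
  refine le_of_mul_le_mul_left ?_ h2
  rw [Finset.mul_sum]
  simp only [card_factorial_mul_det_sum_vecMulVec]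
  have hrew : ∀ k ∈ s, ∑ φ ∈ Fintype.piFinset (fun _ : ι => A k), (of fun i => b (φ i)).det ^ 2 =
      ∑ φ ∈ Fintype.piFinset (fun _ : ι => J),
        if φ ∈ Fintype.piFinset (fun _ : ι => A k) then (of fun i => b (φ i)).det ^ 2 else 0 := by
    intro k hk
    rw [← Finset.sum_filter]
    refine Finset.sum_congr ?_ fun _ _ => rfl
    ext φ
    simp only [Finset.mem_filter, Fintype.mem_piFinset]
    exact ⟨fun h => ⟨fun i => hA k hk (h i), h⟩, fun h => h.2⟩
  rw [Finset.sum_congr rfl hrew, Finset.sum_comm]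
  refine Finset.sum_le_sum fun φ _ => ?_
  by_cases hdet : (of fun i => b (φ i)).det = 0
  · simp [hdet]
  · rw [← Finset.sum_filter, Finset.sum_const, nsmul_eq_mul]
    have hcard : (s.filter fun k => φ ∈ Fintype.piFinset (fun _ : ι => A k)).card ≤ 1 := by
      rw [Finset.card_le_one]
      intro k hk l hl
      by_contra hkl
      simp only [Finset.mem_filter, Fintype.mem_piFinset] at hk hl
      obtain ⟨v, hv, hvb⟩ := hsep k hk.1 l hl.1 hkl
      exact hdet (exists_mulVec_eq_zero_iff.1
        ⟨v, hv, funext fun i => hvb (φ i) (hk.2 i) (hl.2 i)⟩)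
    have : ((s.filter fun k => φ ∈ Fintype.piFinset (fun _ : ι => A k)).card : ℝ) ≤ 1 := by
      exact_mod_cast hcard
    exact mul_le_of_le_one_left (by positivity) this

/-- Symmetric matrices with nonpositive off-diagonal entries, nonnegative row sums and all
cuts bounded below by `c`. -/
structure IsCutMatrix {ι : Type*} [Fintype ι] (c : ℝ) (M : Matrix ι ι ℝ) : Prop where
  symm : ∀ i j, M i j = M j i
  offDiag : ∀ i j, i ≠ j → M i j ≤ 0
  rowSum : ∀ i, 0 ≤ ∑ j, M i j
  cut : ∀ T : Finset ι, T.Nonempty → c ≤ ∑ i ∈ T, ∑ j ∈ T, M i j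

theorem IsCutMatrix.aggregate {ι κ : Type*} [Fintype ι] [Fintype κ] [DecidableEq ι] {c : ℝ}
    {M : Matrix ι ι ℝ} (hM : IsCutMatrix c M) (F : κ → Finset ι) (hne : ∀ k, (F k).Nonempty)
    (hdisj : ∀ k l, k ≠ l → Disjoint (F k) (F l)) {N : Matrix κ κ ℝ}
    (hN : ∀ k l, N k l = ∑ p ∈ F k, ∑ q ∈ F l, M p q) : IsCutMatrix c N := by
  have hd : ∀ T : Finset κ, (T : Set κ).PairwiseDisjoint F := fun T k _ l _ hkl => hdisj k l hkl
  refine ⟨fun k l => ?_, fun k l hkl => ?_, fun k => ?_, fun T hT => ?_⟩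
  · rw [hN, hN]
    refine Finset.sum_comm.trans ?_
    exact Finset.sum_congr rfl fun q _ => Finset.sum_congr rfl fun p _ => hM.symm p q
  · rw [hN]
    refine Finset.sum_nonpos fun p hp => Finset.sum_nonpos fun q hq => hM.offDiag p q ?_
    rintro rfl
    exact Finset.disjoint_left.1 (hdisj k l hkl) hp hq
  · simp only [hN]
    rw [Finset.sum_comm]
    refine Finset.sum_nonneg fun p hp => ?_
    rw [← Finset.sum_biUnion (hd _)]
    refine (hM.rowSum p).trans ?_
    rw [← Finset.sum_sdiff (Finset.subset_univ (Finset.univ.biUnion F))]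
    have : ∑ q ∈ Finset.univ \ Finset.univ.biUnion F, M p q ≤ 0 := by
      refine Finset.sum_nonpos fun q hq => hM.offDiag p q ?_
      rintro rfl
      simp only [Finset.mem_sdiff, Finset.mem_biUnion, Finset.mem_univ, true_and] at hq
      exact hq ⟨k, hp⟩
    linarith
  · have h := hM.cut (T.biUnion F) (by
      obtain ⟨k, hk⟩ := hT
      obtain ⟨p, hp⟩ := hne k
      exact ⟨p, Finset.mem_biUnion.2 ⟨k, hk, hp⟩⟩)
    rw [Finset.sum_biUnion (hd _)] at h
    refine h.trans (le_of_eq (Finset.sum_congr rfl fun k _ => ?_))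
    simp only [hN]
    rw [Finset.sum_comm]
    exact Finset.sum_congr rfl fun p _ => Finset.sum_biUnion (hd _)

open Matrix in
theorem IsCutMatrix.pow_le_det_fin {c : ℝ} (hc : 0 ≤ c) :
    ∀ (m : ℕ) (M : Matrix (Fin m) (Fin m) ℝ), IsCutMatrix c M → (c / 2) ^ m ≤ M.det := by
  intro m
  induction m with
  | zero => intro M _; simp
  | succ m ih =>
    intro M hM
    set a := M.adjugate with ha
    have hsub : ∀ i : Fin (m + 1), ∀ N : Matrix (Fin (m + 1)) (Fin (m + 1)) ℝ,
        N.adjugate i i = (N.submatrix i.succAbove i.succAbove).det := by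
      intro i N
      rw [adjugate_fin_succ_eq_det_submatrix]
      simp [← two_mul]
    have hdiag : ∀ i, (c / 2) ^ m ≤ a i i := by
      intro i
      rw [ha, hsub]
      refine ih _ (hM.aggregate (fun k => {i.succAbove k}) (fun k => by simp) ?_ ?_)
      · intro k l hkl
        simpa using hkl
      · intro k l
        simp
    have hsymm : ∀ i j, a i j = a j i := by
      intro i j
      have hMt : Mᵀ = M := by ext i j; exact hM.symm j i
      have := adjugate_transpose M
      rw [hMt] at this
      rw [ha, ← this, transpose_apply, this]
    have hw : ∀ i j, i ≠ j → (c / 2) ^ m ≤ a i i + a j j - 2 * a i j := by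
      intro i j hij
      have h1 : (transvection i j (-1 : ℝ)).adjugate = transvection i j 1 := by
        have h := mul_adjugate (transvection i j (-1 : ℝ))
        rw [det_transvection_of_ne i j hij, one_smul] at h
        have h' : transvection i j (1 : ℝ) * transvection i j (-1 : ℝ) = 1 := by
          rw [transvection_mul_transvection_same i j hij]; simp
        calc (transvection i j (-1 : ℝ)).adjugate
            = transvection i j 1 * transvection i j (-1) *
                (transvection i j (-1 : ℝ)).adjugate := by rw [h', one_mul]
          _ = _ := by rw [Matrix.mul_assoc, h, mul_one]
      have h1' : (transvection i j (1 : ℝ)).adjugate = transvection i j (-1) := by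
        have h := mul_adjugate (transvection i j (1 : ℝ))
        rw [det_transvection_of_ne i j hij, one_smul] at h
        have h' : transvection i j (-1 : ℝ) * transvection i j (1 : ℝ) = 1 := by
          rw [transvection_mul_transvection_same i j hij]; simp
        calc (transvection i j (1 : ℝ)).adjugate
            = transvection i j (-1) * transvection i j 1 *
                (transvection i j (1 : ℝ)).adjugate := by rw [h', one_mul]
          _ = _ := by rw [Matrix.mul_assoc, h, mul_one]
      have h2 : ((transvection i j (1 : ℝ))ᵀ * M * transvection i j 1).adjugate i i =
          a i i + a j j - 2 * a i j := by
        rw [adjugate_mul_distrib, adjugate_mul_distrib, ← adjugate_transpose, h1', ← ha]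
        simp only [transvection, transpose_add, transpose_one, Matrix.mul_add, Matrix.add_mul,
          Matrix.one_mul, Matrix.mul_one, Matrix.add_apply, transpose_single]
        rw [← Matrix.mul_assoc]
        simp only [single_mul_mul_single, single_apply]
        simp
        rw [hsymm j i]; ring
      rw [← h2, hsub]
      refine ih _ (hM.aggregate
        (fun k => if i.succAbove k = j then {j, i} else {i.succAbove k}) ?_ ?_ ?_)
      · intro k; split_ifs <;> simp
      · intro k l hkl
        have hkl' : i.succAbove k ≠ i.succAbove l := by simpa using hkl
        have hk := i.succAbove_ne k
        have hl := i.succAbove_ne l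
        split_ifs with h3 h4 h4
        · exact absurd (h3.trans h4.symm) hkl'
        · simp [h4, hl]
        · simp [h3, hk]
        · simpa using hkl
      · intro k l
        have hk := i.succAbove_ne k
        have hl := i.succAbove_ne l
        simp only [transvection, transpose_add, transpose_one, Matrix.mul_add, Matrix.add_mul,
          Matrix.one_mul, Matrix.mul_one, transpose_single, submatrix_apply, Matrix.add_apply]
        simp only [single_mul_mul_single, single_apply]
        by_cases h3 : i.succAbove k = j <;> by_cases h4 : i.succAbove l = j
        · simp [h3, h4, Finset.sum_pair hij.symm]; ring
        · simp [h3, h4, Finset.sum_pair hij.symm, Ne.symm h4]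
        · simp [h3, h4, Finset.sum_pair hij.symm, Ne.symm h3]
        · simp [h3, h4, Ne.symm h3, Ne.symm h4]
    have htr : ((m + 1 : ℕ) : ℝ) * M.det = ∑ i, ∑ j, M i j * a i j := by
      have h := congrArg trace (mul_adjugate M)
      rw [trace_smul, trace_one, smul_eq_mul, Fintype.card_fin] at h
      rw [mul_comm, ← h, ← ha]
      simp only [trace, diag, mul_apply]
      exact Finset.sum_congr rfl fun i _ => Finset.sum_congr rfl fun j _ => by rw [hsymm i j]
    set β := (c / 2) ^ m with hβ
    have hβ0 : 0 ≤ β := by positivity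
    have hterm : ∀ i j, M i j * ((a i i + a j j) / 2) - M i j / 2 * β +
        (if i = j then M i i / 2 * β else 0) ≤ M i j * a i j := by
      intro i j
      by_cases hij : i = j
      · subst hij
        simp
      · have h1 := hw i j hij
        have h2 := hM.offDiag i j hij
        simp only [hij, if_false]
        nlinarith
    have hrow : ∑ i, ∑ j, M i j * ((a i i + a j j) / 2) = ∑ i, (∑ j, M i j) * a i i := by
      have e1 : ∑ i, ∑ j, M i j * ((a i i + a j j) / 2) =
          (∑ i, ∑ j, M i j * a i i) / 2 + (∑ i, ∑ j, M i j * a j j) / 2 := by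
        rw [← add_div, ← Finset.sum_add_distrib, Finset.sum_div]
        refine Finset.sum_congr rfl fun i _ => ?_
        rw [← Finset.sum_add_distrib, Finset.sum_div]
        exact Finset.sum_congr rfl fun j _ => by ring
      have e2 : ∑ i, ∑ j, M i j * a j j = ∑ i, ∑ j, M i j * a i i := by
        rw [Finset.sum_comm]
        exact Finset.sum_congr rfl fun i _ => Finset.sum_congr rfl fun j _ => by
          rw [hM.symm j i]
      rw [e1, e2]
      simp only [Finset.sum_mul]
      ring
    have hlow := Finset.sum_le_sum fun i (_ : i ∈ Finset.univ) =>
      Finset.sum_le_sum fun j (_ : j ∈ Finset.univ) => hterm i j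
    rw [← htr] at hlow
    simp only [Finset.sum_add_distrib, Finset.sum_sub_distrib, Finset.sum_ite_eq,
      Finset.mem_univ, if_true, hrow] at hlow
    have hr : ∑ i, (∑ j, M i j) * β ≤ ∑ i, (∑ j, M i j) * a i i :=
      Finset.sum_le_sum fun i _ => mul_le_mul_of_nonneg_left (hdiag i) (hM.rowSum i)
    have hcc : ∑ i : Fin (m + 1), c * β ≤ ∑ i, M i i * β :=
      Finset.sum_le_sum fun i _ => mul_le_mul_of_nonneg_right
        (by simpa using hM.cut {i} (by simp)) hβ0
    have hrr : 0 ≤ ∑ i, (∑ j, M i j) * β :=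
      Finset.sum_nonneg fun i _ => mul_nonneg (hM.rowSum i) hβ0
    have e3 : ∑ i, ∑ j, M i j / 2 * β = (∑ i, (∑ j, M i j) * β) / 2 := by
      rw [Finset.sum_div]
      refine Finset.sum_congr rfl fun i _ => ?_
      rw [Finset.sum_mul, Finset.sum_div]
      exact Finset.sum_congr rfl fun j _ => by ring
    have e4 : ∑ i, M i i / 2 * β = (∑ i, M i i * β) / 2 := by
      rw [Finset.sum_div]
      exact Finset.sum_congr rfl fun j _ => by ring
    rw [e3, e4] at hlow
    simp only [Finset.sum_const, Finset.card_univ, Fintype.card_fin, nsmul_eq_mul] at hcc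
    have hfin : ((m + 1 : ℕ) : ℝ) * (c / 2) ^ (m + 1) ≤ ((m + 1 : ℕ) : ℝ) * M.det := by
      rw [pow_succ, ← hβ]
      linarith
    exact le_of_mul_le_mul_left hfin (by positivity)

open Matrix in
theorem IsCutMatrix.pow_le_det {ι : Type*} [Fintype ι] [DecidableEq ι] {c : ℝ} (hc : 0 ≤ c)
    {M : Matrix ι ι ℝ} (hM : IsCutMatrix c M) : (c / 2) ^ Fintype.card ι ≤ M.det := by
  let e := (Fintype.equivFin ι).symm
  rw [← det_submatrix_equiv_self e M]
  refine IsCutMatrix.pow_le_det_fin hc _ _ (hM.aggregate (fun k => {e k}) (by simp) ?_ (by simp))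
  intro k l hkl
  simpa using hkl

open Matrix in
/-- Completing the square: the Schur complement computes the minimum of the quadratic form
over extensions. -/
theorem fromBlocks_quadForm {m n : Type*} [Fintype m] [Fintype n] [DecidableEq n]
    (A : Matrix m m ℝ) (B : Matrix m n ℝ) {D : Matrix n n ℝ} (hD : D.PosDef)
    (x : m → ℝ) (y : n → ℝ) :
    Sum.elim x y ⬝ᵥ fromBlocks A B Bᵀ D *ᵥ Sum.elim x y =
      ((D⁻¹ * Bᵀ) *ᵥ x + y) ⬝ᵥ D *ᵥ ((D⁻¹ * Bᵀ) *ᵥ x + y) +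
        x ⬝ᵥ (A - B * D⁻¹ * Bᵀ) *ᵥ x := by
  have : Invertible D := hD.isUnit.invertible
  have h := schur_complement_eq₂₂ A B x y hD.isHermitian
  simpa only [star_trivial, conjTranspose_eq_transpose_of_trivial, ← dotProduct_mulVec] using h

open Matrix in
theorem Matrix.PosSemidef.det_le_pow {m : Type*} [Fintype m] [DecidableEq m] {A : Matrix m m ℝ}
    (hA : A.PosSemidef) (M : ℝ) (hM : ∀ x : m → ℝ, x ⬝ᵥ A *ᵥ x ≤ M * ∑ i, x i ^ 2) :
    A.det ≤ M ^ Fintype.card m := by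
  have hdet := hA.isHermitian.det_eq_prod_eigenvalues
  simp only [RCLike.ofReal_real_eq_id, id_eq] at hdet
  rw [hdet, ← Finset.card_univ, ← Finset.prod_const]
  refine Finset.prod_le_prod (fun i _ => hA.eigenvalues_nonneg i) fun i _ => ?_
  rw [hA.isHermitian.eigenvalues_eq]
  simp only [star_trivial, RCLike.re_to_real]
  refine (hM _).trans (le_of_eq ?_)
  have h1 := hA.isHermitian.eigenvectorBasis.orthonormal.1 i
  have h2 := EuclideanSpace.norm_sq_eq (hA.isHermitian.eigenvectorBasis i)
  rw [h1] at h2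
  simp only [Real.norm_eq_abs, sq_abs, one_pow] at h2
  rw [← h2, mul_one]

/-- A symmetric form that decreases under `f ↦ |f|` and `f ↦ min f 1`. -/
structure IsMarkovForm {ι : Type*} [Fintype ι] (L : Matrix ι ι ℝ) : Prop where
  symm : L.IsSymm
  abs_le : ∀ f : ι → ℝ, (fun i => |f i|) ⬝ᵥ L.mulVec (fun i => |f i|) ≤ f ⬝ᵥ L.mulVec f
  min_le : ∀ f : ι → ℝ, (fun i => min (f i) 1) ⬝ᵥ L.mulVec (fun i => min (f i) 1) ≤
    f ⬝ᵥ L.mulVec f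

open Matrix in
theorem IsMarkovForm.isCutMatrix {m : Type*} [Fintype m] [DecidableEq m] {c : ℝ} (hc : 0 ≤ c)
    {L : Matrix m m ℝ} (hL : IsMarkovForm L)
    (hcut : ∀ T : Finset m, T.Nonempty →
      c ≤ (fun i => if i ∈ T then (1 : ℝ) else 0) ⬝ᵥ L *ᵥ (fun i => if i ∈ T then (1 : ℝ) else 0)) :
    IsCutMatrix c L := by
  have hs : ∀ i j, L i j = L j i := fun i j => hL.symm.apply j i
  have hcut' : ∀ T : Finset m, T.Nonempty → c ≤ ∑ i ∈ T, ∑ j ∈ T, L i j := by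
    intro T hT
    refine (hcut T hT).trans (le_of_eq ?_)
    simp [dotProduct, mulVec, Finset.sum_ite_mem]
  refine ⟨hs, fun i j hij => ?_, fun i => ?_, hcut'⟩
  · have h := hL.abs_le (Pi.single i 1 - Pi.single j 1)
    have e : (fun k => |(Pi.single i (1 : ℝ) - Pi.single j 1 : m → ℝ) k|) =
        Pi.single i 1 + Pi.single j 1 := by
      funext k
      by_cases hki : k = i
      · subst hki; simp [hij]
      · by_cases hkj : k = j
        · subst hkj; simp [hij.symm]
        · simp [hki, hkj]
    rw [e] at h
    simp [mulVec_add, mulVec_sub, add_dotProduct, sub_dotProduct, hs j i] at h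
    linarith
  · by_contra hneg
    push Not at hneg
    set r := ∑ j, L i j with hr
    have hii : 0 ≤ L i i := hc.trans (by simpa using hcut' {i} (by simp))
    set t := -r / (L i i + 1) with ht
    have htpos : 0 < t := div_pos (by linarith) (by linarith)
    have h := hL.min_le ((fun _ => 1) + Pi.single i t)
    have e : (fun k => min (((fun _ => 1) + Pi.single i t : m → ℝ) k) 1) = fun _ => (1 : ℝ) := by
      funext k
      by_cases hki : k = i
      · subst hki; simp [htpos.le]
      · simp [hki]
    rw [e] at h
    have hr1 : (L *ᵥ fun _ => (1 : ℝ)) i = r := by simp [mulVec, dotProduct, hr]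
    have hr2 : (fun _ => (1 : ℝ)) ⬝ᵥ L *ᵥ Pi.single i t = t * r := by
      simp [dotProduct, hr, Finset.mul_sum, hs i, mul_comm]
    rw [mulVec_add, add_dotProduct, dotProduct_add, dotProduct_add, hr2] at h
    rw [single_dotProduct, single_dotProduct, hr1] at h
    simp at h
    have ht2 : t * (L i i + 1) = -r := by rw [ht]; field_simp
    nlinarith

open Matrix in
/-- Comparing two determinants whose matrices agree off a set `p` of indices. -/
theorem pow_mul_det_le_pow_mul_det {ι : Type*} [Fintype ι] [DecidableEq ι] (p : ι → Prop)
    [DecidablePred p] {c M : ℝ} (hc : 0 ≤ c) {L L' : Matrix ι ι ℝ} (hL : IsMarkovForm L)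
    (hL' : L'.PosDef) (hagree : ∀ i j, ¬ p i → ¬ p j → L i j = L' i j)
    (hcut : ∀ f : ι → ℝ, (∀ i, p i → f i = 0 ∨ f i = 1) → (∃ i, p i ∧ f i = 1) →
      c ≤ f ⬝ᵥ L *ᵥ f)
    (hM : ∀ f : ι → ℝ, f ⬝ᵥ L' *ᵥ f ≤ M * ∑ i, f i ^ 2) :
    (c / 2) ^ Fintype.card {i // p i} * L'.det ≤ M ^ Fintype.card {i // p i} * L.det := by
  classical
  let e : {i // p i} ⊕ {i // ¬ p i} ≃ ι := Equiv.sumCompl p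
  let A := (L.submatrix e e).toBlocks₁₁
  let B := (L.submatrix e e).toBlocks₁₂
  let A' := (L'.submatrix e e).toBlocks₁₁
  let B' := (L'.submatrix e e).toBlocks₁₂
  let D := (L'.submatrix e e).toBlocks₂₂
  have hsymm' : ∀ i j, L' i j = L' j i := fun i j => by
    simpa using hL'.isHermitian.apply j i
  have hblocks : L.submatrix e e = fromBlocks A B Bᵀ D := by
    conv_lhs => rw [← fromBlocks_toBlocks (L.submatrix e e)]
    congr 1
    · ext i j
      exact hL.symm.apply _ _
    · ext i j
      exact hagree _ _ i.2 j.2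
  have hblocks' : L'.submatrix e e = fromBlocks A' B' B'ᵀ D := by
    conv_lhs => rw [← fromBlocks_toBlocks (L'.submatrix e e)]
    congr 1
    ext i j
    exact hsymm' _ _
  have hD : D.PosDef := by
    have := hL'.submatrix (e := fun i : {i // ¬ p i} => (i : ι)) Subtype.val_injective
    exact this
  have hform : ∀ (N : Matrix ι ι ℝ) (f : ι → ℝ),
      (f ∘ e) ⬝ᵥ N.submatrix e e *ᵥ (f ∘ e) = f ⬝ᵥ N *ᵥ f := by
    intro N f
    rw [submatrix_mulVec_equiv]
    simp only [Function.comp_assoc, Equiv.self_comp_symm, Function.comp_id]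
    exact comp_equiv_dotProduct_comp_equiv _ _ e
  have hformL : ∀ (x : {i // p i} → ℝ) (y : {i // ¬ p i} → ℝ),
      (Sum.elim x y ∘ e.symm) ⬝ᵥ L *ᵥ (Sum.elim x y ∘ e.symm) =
      ((D⁻¹ * Bᵀ) *ᵥ x + y) ⬝ᵥ D *ᵥ ((D⁻¹ * Bᵀ) *ᵥ x + y) +
        x ⬝ᵥ (A - B * D⁻¹ * Bᵀ) *ᵥ x := by
    intro x y
    rw [← fromBlocks_quadForm A B hD, ← hblocks, ← hform]
    simp [Function.comp_assoc]
  have hformL' : ∀ (x : {i // p i} → ℝ) (y : {i // ¬ p i} → ℝ),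
      (Sum.elim x y ∘ e.symm) ⬝ᵥ L' *ᵥ (Sum.elim x y ∘ e.symm) =
      ((D⁻¹ * B'ᵀ) *ᵥ x + y) ⬝ᵥ D *ᵥ ((D⁻¹ * B'ᵀ) *ᵥ x + y) +
        x ⬝ᵥ (A' - B' * D⁻¹ * B'ᵀ) *ᵥ x := by
    intro x y
    rw [← fromBlocks_quadForm A' B' hD, ← hblocks', ← hform]
    simp [Function.comp_assoc]
  have hDnn : ∀ z, 0 ≤ z ⬝ᵥ D *ᵥ z := fun z => by
    simpa using hD.posSemidef.dotProduct_mulVec_nonneg z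
  have hmin : ∀ x y, x ⬝ᵥ (A - B * D⁻¹ * Bᵀ) *ᵥ x ≤
      (Sum.elim x y ∘ e.symm) ⬝ᵥ L *ᵥ (Sum.elim x y ∘ e.symm) := fun x y => by
    rw [hformL]
    linarith [hDnn ((D⁻¹ * Bᵀ) *ᵥ x + y)]
  have hatt : ∀ x, x ⬝ᵥ (A - B * D⁻¹ * Bᵀ) *ᵥ x =
      (Sum.elim x (-((D⁻¹ * Bᵀ) *ᵥ x)) ∘ e.symm) ⬝ᵥ
        L *ᵥ (Sum.elim x (-((D⁻¹ * Bᵀ) *ᵥ x)) ∘ e.symm) := fun x => by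
    rw [hformL]
    simp
  have hAsymm : A.IsSymm := by
    ext i j
    exact hL.symm.apply _ _
  have hDinv : D⁻¹.IsSymm := by
    have := hD.inv.isHermitian
    simpa [IsHermitian, IsSymm, conjTranspose_eq_transpose_of_trivial] using this
  have hA'symm : A'.IsSymm := by
    ext i j
    exact hsymm' _ _
  have hschur : IsMarkovForm (A - B * D⁻¹ * Bᵀ) := by
    refine ⟨?_, fun x => ?_, fun x => ?_⟩
    · simp [IsSymm, transpose_mul, hAsymm.eq, hDinv.eq, Matrix.mul_assoc]
    · rw [hatt x]
      refine le_trans ?_ (hL.abs_le _)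
      refine (hmin _ (fun i => |(-((D⁻¹ * Bᵀ) *ᵥ x)) i|)).trans (le_of_eq ?_)
      congr 1
      · funext i
        simp only [Function.comp]
        cases e.symm i <;> simp
      · congr 1
        funext i
        simp only [Function.comp]
        cases e.symm i <;> simp
    · rw [hatt x]
      refine le_trans ?_ (hL.min_le _)
      refine (hmin _ (fun i => min ((-((D⁻¹ * Bᵀ) *ᵥ x)) i) 1)).trans (le_of_eq ?_)
      congr 1
      · funext i
        simp only [Function.comp]
        cases e.symm i <;> simp
      · congr 1
        funext i
        simp only [Function.comp]
        cases e.symm i <;> simp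
  have hcutM : IsCutMatrix c (A - B * D⁻¹ * Bᵀ) := by
    refine hschur.isCutMatrix hc fun T hT => ?_
    rw [hatt]
    refine hcut _ (fun i hi => ?_) ?_
    · have : e.symm i = Sum.inl ⟨i, hi⟩ := by
        rw [Equiv.symm_apply_eq]; rfl
      simp only [Function.comp, this, Sum.elim_inl]
      split_ifs <;> simp
    · obtain ⟨k, hk⟩ := hT
      refine ⟨k, k.2, ?_⟩
      have : e.symm k = Sum.inl k := by
        rw [Equiv.symm_apply_eq]; rfl
      simp [Function.comp, this, hk]
  have hlow := hcutM.pow_le_det hc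
  have hPSD : (A' - B' * D⁻¹ * B'ᵀ).PosSemidef := by
    refine PosSemidef.of_dotProduct_mulVec_nonneg ?_ fun x => ?_
    · rw [IsHermitian, conjTranspose_eq_transpose_of_trivial]
      simp [transpose_mul, hA'symm.eq, hDinv.eq, Matrix.mul_assoc]
    · have h := hformL' x (-((D⁻¹ * B'ᵀ) *ᵥ x))
      simp only [add_neg_cancel, zero_dotProduct, zero_add] at h
      rw [star_trivial, ← h]
      simpa using hL'.posSemidef.dotProduct_mulVec_nonneg
        (Sum.elim x (-((D⁻¹ * B'ᵀ) *ᵥ x)) ∘ e.symm)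
  have hup := hPSD.det_le_pow M (fun x => by
    have h := hformL' x 0
    have h1 := hM (Sum.elim x 0 ∘ e.symm)
    rw [h] at h1
    have h2 : ∑ i, (Sum.elim x 0 ∘ e.symm) i ^ 2 = ∑ i, x i ^ 2 := by
      rw [← e.sum_comp]
      simp
    rw [h2] at h1
    linarith [hDnn ((D⁻¹ * B'ᵀ) *ᵥ x + 0)])
  have : Invertible D := hD.isUnit.invertible
  have hdetL : L.det = D.det * (A - B * D⁻¹ * Bᵀ).det := by
    rw [← det_submatrix_equiv_self e L, hblocks, det_fromBlocks₂₂, invOf_eq_nonsing_inv]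
  have hdetL' : L'.det = D.det * (A' - B' * D⁻¹ * B'ᵀ).det := by
    rw [← det_submatrix_equiv_self e L', hblocks', det_fromBlocks₂₂, invOf_eq_nonsing_inv]
  have hDdet : 0 < D.det := hD.det_pos
  have hdn : 0 ≤ (A' - B' * D⁻¹ * B'ᵀ).det := hPSD.det_nonneg
  have h0 : (0 : ℝ) ≤ (c / 2) ^ Fintype.card {i // p i} := by positivity
  have hSdet : 0 ≤ (A - B * D⁻¹ * Bᵀ).det := h0.trans hlow
  rw [hdetL, hdetL']
  calc (c / 2) ^ Fintype.card {i // p i} * (D.det * (A' - B' * D⁻¹ * B'ᵀ).det)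
      = D.det * ((c / 2) ^ Fintype.card {i // p i} * (A' - B' * D⁻¹ * B'ᵀ).det) := by ring
    _ ≤ D.det * ((A - B * D⁻¹ * Bᵀ).det * M ^ Fintype.card {i // p i}) := by gcongr
    _ = _ := by ring

namespace SimpleGraph

variable {V : Type*}

/-- The Dirichlet energy of a function along a finite set of ordered pairs. -/
def energy (A : Finset (V × V)) (f : V → ℝ) : ℝ := ∑ e ∈ A, (f e.1 - f e.2) ^ 2

theorem energy_comp_le (A : Finset (V × V)) (f : V → ℝ) {ψ : ℝ → ℝ}
    (hψ : ∀ a b, |ψ a - ψ b| ≤ |a - b|) : energy A (fun v => ψ (f v)) ≤ energy A f :=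
  Finset.sum_le_sum fun _ _ => sq_le_sq.2 (hψ _ _)

section Thicken

variable [DecidableEq V] (G : SimpleGraph V) [G.LocallyFinite]

/-- A finite vertex set together with all its neighbours. -/
def thicken (U : Finset V) : Finset V := U ∪ U.biUnion fun v => G.neighborFinset v

variable {G} in
theorem mem_thicken {U : Finset V} {v : V} :
    v ∈ G.thicken U ↔ v ∈ U ∨ ∃ u ∈ U, G.Adj u v := by
  simp [thicken]

end Thicken

variable (G : SimpleGraph V) [DecidableRel G.Adj]

/-- The ordered pairs of adjacent vertices in a finite vertex set. -/
def dartsIn (X : Finset V) : Finset (V × V) := (X ×ˢ X).filter fun e => G.Adj e.1 e.2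

variable {G} in
theorem mem_dartsIn {X : Finset V} {e : V × V} :
    e ∈ G.dartsIn X ↔ e.1 ∈ X ∧ e.2 ∈ X ∧ G.Adj e.1 e.2 := by
  simp [dartsIn, and_assoc]

variable [DecidableEq V] [G.LocallyFinite]

/-- The ordered pairs `(x, y)` of adjacent vertices with `x ∈ K` and `y ∉ K`. -/
def edgeBoundary (K : Finset V) : Finset (V × V) :=
  (K ×ˢ G.thicken K).filter fun e => G.Adj e.1 e.2 ∧ e.2 ∉ K

/-- The adjacent pairs in the thickening of `U` that do not cross the boundary of `K`. -/
def nonCrossing (U K : Finset V) : Finset (V × V) :=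
  (G.dartsIn (G.thicken U)).filter fun e => e.1 ∈ K ↔ e.2 ∈ K

/-- Every endpoint of a boundary edge of `K` is linked to `S` or to the complement of `U` without
crossing the boundary of `K`. -/
def IsGoodCut (U S K : Finset V) : Prop :=
  ∀ e ∈ G.edgeBoundary K, ∀ x, x = e.1 ∨ x = e.2 →
    ∃ y, Relation.ReflTransGen (fun a b => G.Adj a b ∧ (a ∈ K ↔ b ∈ K)) x y ∧ (y ∈ S ∨ y ∉ U)

variable {G}

theorem mem_edgeBoundary {K : Finset V} {e : V × V} :
    e ∈ G.edgeBoundary K ↔ e.1 ∈ K ∧ e.2 ∉ K ∧ G.Adj e.1 e.2 := by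
  simp only [edgeBoundary, Finset.mem_filter, Finset.mem_product, mem_thicken]
  exact ⟨fun h => ⟨h.1.1, h.2.2, h.2.1⟩,
    fun h => ⟨⟨h.1, Or.inr ⟨e.1, h.1, h.2.2⟩⟩, h.2.2, h.2.1⟩⟩

theorem mem_nonCrossing {U K : Finset V} {e : V × V} :
    e ∈ G.nonCrossing U K ↔ e ∈ G.dartsIn (G.thicken U) ∧ (e.1 ∈ K ↔ e.2 ∈ K) := by
  simp [nonCrossing]

theorem mem_dartsIn_thicken_of_adj {U : Finset V} {a b : V} (ha : a ∈ U) (h : G.Adj a b) :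
    (a, b) ∈ G.dartsIn (G.thicken U) := by
  simp only [mem_dartsIn, mem_thicken]
  exact ⟨Or.inl ha, Or.inr ⟨a, ha, h⟩, h⟩

theorem nonCrossing_subset (U K : Finset V) :
    G.nonCrossing U K ⊆ G.dartsIn (G.thicken U) := Finset.filter_subset _ _

theorem endpoint_of_not_mem_nonCrossing {U K : Finset V} {e : V × V}
    (he : e ∈ G.dartsIn (G.thicken U)) (he' : e ∉ G.nonCrossing U K) :
    ∃ e' ∈ G.edgeBoundary K, (e.1 = e'.1 ∨ e.1 = e'.2) ∧ (e.2 = e'.1 ∨ e.2 = e'.2) := by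
  rw [mem_nonCrossing] at he'
  have hadj := (mem_dartsIn.1 he).2.2
  by_cases h1 : e.1 ∈ K
  · have h2 : e.2 ∉ K := fun h2 => he' ⟨he, by simp [h1, h2]⟩
    exact ⟨e, mem_edgeBoundary.2 ⟨h1, h2, hadj⟩, Or.inl rfl, Or.inr rfl⟩
  · have h2 : e.2 ∈ K := by
      by_contra h2
      exact he' ⟨he, by simp [h1, h2]⟩
    exact ⟨(e.2, e.1), mem_edgeBoundary.2 ⟨h2, h1, hadj.symm⟩, Or.inr rfl, Or.inl rfl⟩

/-- If `f` jumps from `1` to `0` along a path that avoids the boundary of `K`, and takes only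
the values `0` and `1` at the boundary of `K`, then its energy off this boundary is bounded
below. -/
theorem min_le_energy_nonCrossing {U S K : Finset V} {r : ℝ} (hr : 0 < r)
    (hgreen : ∀ h : V → ℝ, (∀ v, v ∉ U → h v = 0) →
      ∀ z, h z ^ 2 ≤ r * energy (G.dartsIn (G.thicken U)) h)
    {f : V → ℝ} (hf : ∀ v, v ∈ S ∨ v ∉ U → f v = 0)
    (hB : ∀ e ∈ G.edgeBoundary K, ∀ x, x = e.1 ∨ x = e.2 → f x = 0 ∨ f x = 1)
    {x y : V} (hx : f x = 1)
    (hxy : Relation.ReflTransGen (fun a b => G.Adj a b ∧ (a ∈ K ↔ b ∈ K)) x y)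
    (hy : y ∈ S ∨ y ∉ U) :
    min (1 / 16) (1 / (16 * r)) ≤ energy (G.nonCrossing U K) f := by
  by_contra hlt
  push Not at hlt
  set E := energy (G.nonCrossing U K) f with hE
  have hE1 : E < 1 / 16 := hlt.trans_le (min_le_left _ _)
  have hE2 : r * E < 1 / 16 := by
    have := mul_lt_mul_of_pos_left (hlt.trans_le (min_le_right _ _)) hr
    calc r * E < r * (1 / (16 * r)) := this
      _ = 1 / 16 := by field_simp
  set ψ : ℝ → ℝ := fun s => max 0 (min s (1 - s)) with hψ
  have hψ0 : ψ 0 = 0 := by simp [hψ]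
  have hψ1 : ψ 1 = 0 := by simp [hψ]
  have hψL : ∀ a b, |ψ a - ψ b| ≤ |a - b| := by
    intro a b
    refine (abs_max_sub_max_le_max _ _ _ _).trans (max_le (by simp) ?_)
    refine (abs_min_sub_min_le_max _ _ _ _).trans ?_
    refine max_le le_rfl (le_of_eq ?_)
    rw [abs_sub_comm]
    congr 1
    ring
  have hval : ∀ v, ψ (f v) < 1 / 4 := by
    intro v
    have h1 := hgreen (fun v => ψ (f v)) (fun v hv => by simp [hf v (Or.inr hv), hψ0]) v
    have h2 : energy (G.dartsIn (G.thicken U)) (fun v => ψ (f v)) =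
        energy (G.nonCrossing U K) (fun v => ψ (f v)) := by
      refine (Finset.sum_subset (nonCrossing_subset U K) fun e he he' => ?_).symm
      obtain ⟨e', he'', h1, h2⟩ := endpoint_of_not_mem_nonCrossing he he'
      have e1 : ψ (f e.1) = 0 := by
        rcases hB e' he'' _ h1 with h | h <;> rw [h] <;> assumption
      have e2 : ψ (f e.2) = 0 := by
        rcases hB e' he'' _ h2 with h | h <;> rw [h] <;> assumption
      simp [e1, e2]
    rw [h2] at h1
    have h3 := energy_comp_le (G.nonCrossing U K) f hψL
    have h4 : ψ (f v) ^ 2 < (1 / 4) ^ 2 := by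
      calc ψ (f v) ^ 2 ≤ r * energy (G.nonCrossing U K) (fun v => ψ (f v)) := h1
        _ ≤ r * E := mul_le_mul_of_nonneg_left h3 hr.le
        _ < (1 / 4) ^ 2 := by linarith
    exact lt_of_pow_lt_pow_left₀ 2 (by norm_num) h4
  have hstep : ∀ e ∈ G.nonCrossing U K, |f e.1 - f e.2| < 1 / 4 := by
    intro e he
    have h1 : (f e.1 - f e.2) ^ 2 ≤ E :=
      Finset.single_le_sum (f := fun e : V × V => (f e.1 - f e.2) ^ 2)
        (fun _ _ => sq_nonneg _) he
    have h2 : |f e.1 - f e.2| ^ 2 < (1 / 4) ^ 2 := by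
      rw [sq_abs]; linarith
    exact lt_of_pow_lt_pow_left₀ 2 (by norm_num) h2
  have key : ∀ y, Relation.ReflTransGen (fun a b => G.Adj a b ∧ (a ∈ K ↔ b ∈ K)) x y →
      3 / 4 < f y := by
    intro y hxy
    induction hxy with
    | refl => rw [hx]; norm_num
    | @tail a b _ hab ih =>
      have haU : a ∈ U := by
        by_contra haU
        rw [hf a (Or.inr haU)] at ih
        norm_num at ih
      have h1 := abs_lt.1 (hstep (a, b)
        (mem_nonCrossing.2 ⟨mem_dartsIn_thicken_of_adj haU hab.1, hab.2⟩))
      have h2 : min (f b) (1 - f b) < 1 / 4 := (le_max_right _ _).trans_lt (hval b)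
      rcases min_lt_iff.1 h2 with h3 | h3
      · have := h1.2
        simp only at this
        linarith
      · linarith
  have hy' := key y hxy
  rw [hf y hy] at hy'
  norm_num at hy'

end SimpleGraph

namespace SimpleGraph

section Incidence

variable {V : Type*} [DecidableEq V]

/-- Extension by zero of a function on a finite set. -/
def extendZero (W : Finset V) (f : W → ℝ) (v : V) : ℝ := if h : v ∈ W then f ⟨v, h⟩ else 0

/-- The incidence vector of an ordered pair, restricted to a finite set. -/
def incVec (W : Finset V) (e : V × V) (w : W) : ℝ :=
  (if e.1 = w then 1 else 0) - (if e.2 = w then 1 else 0)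

/-- The Laplacian associated to a finite set of ordered pairs, with Dirichlet boundary conditions
off `W`. -/
def dirLap (W : Finset V) (A : Finset (V × V)) : Matrix W W ℝ :=
  ∑ e ∈ A, Matrix.vecMulVec (incVec W e) (incVec W e)

theorem extendZero_coe (W : Finset V) (f : W → ℝ) (w : W) : extendZero W f w = f w := by
  simp [extendZero]

theorem extendZero_of_notMem {W : Finset V} (f : W → ℝ) {v : V} (hv : v ∉ W) :
    extendZero W f v = 0 := by
  simp [extendZero, hv]

theorem extendZero_comp (W : Finset V) (f : W → ℝ) {ψ : ℝ → ℝ} (hψ : ψ 0 = 0) :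
    extendZero W (fun w => ψ (f w)) = fun v => ψ (extendZero W f v) := by
  funext v
  by_cases h : v ∈ W <;> simp [extendZero, h, hψ]

theorem incVec_dotProduct (W : Finset V) (e : V × V) (f : W → ℝ) :
    incVec W e ⬝ᵥ f = extendZero W f e.1 - extendZero W f e.2 := by
  have h : ∀ v : V, ∑ w : W, (if v = (w : V) then (1 : ℝ) else 0) * f w = extendZero W f v := by
    intro v
    by_cases hv : v ∈ W
    · rw [Finset.sum_eq_single ⟨v, hv⟩]
      · simp [extendZero, hv]
      · rintro ⟨w, hw⟩ _ hne
        have : v ≠ w := fun h => hne (Subtype.ext h.symm)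
        simp [this]
      · simp
    · rw [extendZero_of_notMem f hv]
      refine Finset.sum_eq_zero fun w _ => ?_
      have : v ≠ w := fun h => hv (h ▸ w.2)
      simp [this]
  simp only [dotProduct, incVec, sub_mul, Finset.sum_sub_distrib, h]

open Matrix in
theorem dirLap_quadForm (W : Finset V) (A : Finset (V × V)) (f : W → ℝ) :
    f ⬝ᵥ dirLap W A *ᵥ f = energy A (extendZero W f) := by
  rw [dirLap, sum_mulVec, dotProduct_sum]
  refine Finset.sum_congr rfl fun e _ => ?_
  rw [vecMulVec_mulVec, ← incVec_dotProduct, pow_two, dotProduct_smul, dotProduct_comm f]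
  simp

theorem dirLap_isMarkovForm (W : Finset V) (A : Finset (V × V)) : IsMarkovForm (dirLap W A) := by
  refine ⟨?_, fun f => ?_, fun f => ?_⟩
  · ext i j
    simp [dirLap, Matrix.sum_apply, Matrix.vecMulVec_apply, mul_comm]
  · rw [dirLap_quadForm, dirLap_quadForm, extendZero_comp W f (ψ := fun x => |x|) abs_zero]
    exact energy_comp_le A (extendZero W f) (ψ := fun x => |x|) fun a b => abs_abs_sub_abs_le a b
  · rw [dirLap_quadForm, dirLap_quadForm, extendZero_comp W f (ψ := fun x => min x 1) (by simp)]
    exact energy_comp_le A (extendZero W f) (ψ := fun x => min x 1) fun a b =>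
      (abs_min_sub_min_le_max a 1 b 1).trans (by simp)

end Incidence

variable {V : Type*} [DecidableEq V] {G : SimpleGraph V} [G.LocallyFinite] [DecidableRel G.Adj]

theorem energy_dartsIn_le {D : ℕ} (hdeg : ∀ x, G.degree x ≤ D) (X W : Finset V) (f : V → ℝ)
    (hf : ∀ v, v ∉ W → f v = 0) :
    energy (G.dartsIn X) f ≤ 4 * D * ∑ v ∈ W, f v ^ 2 := by
  have h1 : ∀ (Y : Finset V), ∑ e ∈ G.dartsIn Y, f e.1 ^ 2 ≤ D * ∑ v ∈ W, f v ^ 2 := by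
    intro Y
    have e1 : ∑ e ∈ G.dartsIn Y, f e.1 ^ 2 =
        ∑ v ∈ Y, ((Y.filter fun y => G.Adj v y).card : ℝ) * f v ^ 2 := by
      rw [dartsIn, Finset.sum_filter, Finset.sum_product]
      refine Finset.sum_congr rfl fun v _ => ?_
      rw [← Finset.sum_filter]
      simp
    have e2 : ∀ v, ((Y.filter fun y => G.Adj v y).card : ℝ) ≤ D := by
      intro v
      have : (Y.filter fun y => G.Adj v y).card ≤ G.degree v :=
        Finset.card_le_card fun y hy => by
          simpa using (Finset.mem_filter.1 hy).2
      exact_mod_cast this.trans (hdeg v)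
    rw [e1]
    calc ∑ v ∈ Y, ((Y.filter fun y => G.Adj v y).card : ℝ) * f v ^ 2
        ≤ ∑ v ∈ Y, (D : ℝ) * f v ^ 2 := 
        Finset.sum_le_sum fun v _ => mul_le_mul_of_nonneg_right (e2 v) (sq_nonneg _)
      _ ≤ ∑ v ∈ Y ∪ W, (D : ℝ) * f v ^ 2 :=
        Finset.sum_le_sum_of_subset_of_nonneg Finset.subset_union_left fun _ _ _ => by positivity
      _ = ∑ v ∈ W, (D : ℝ) * f v ^ 2 :=
        (Finset.sum_subset Finset.subset_union_right fun v _ hv => by simp [hf v hv]).symm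
      _ = _ := by rw [Finset.mul_sum]
  have h2 : ∑ e ∈ G.dartsIn X, f e.2 ^ 2 = ∑ e ∈ G.dartsIn X, f e.1 ^ 2 := by
    refine Finset.sum_nbij' Prod.swap Prod.swap ?_ ?_ ?_ ?_ ?_
    · intro e he
      rw [mem_dartsIn] at he ⊢
      exact ⟨he.2.1, he.1, he.2.2.symm⟩
    · intro e he
      rw [mem_dartsIn] at he ⊢
      exact ⟨he.2.1, he.1, he.2.2.symm⟩
    all_goals simp
  calc energy (G.dartsIn X) f ≤ ∑ e ∈ G.dartsIn X, (2 * f e.1 ^ 2 + 2 * f e.2 ^ 2) :=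
        Finset.sum_le_sum fun e _ => by nlinarith [sq_nonneg (f e.1 + f e.2)]
    _ = 4 * ∑ e ∈ G.dartsIn X, f e.1 ^ 2 := by
        rw [Finset.sum_add_distrib, ← Finset.mul_sum, ← Finset.mul_sum, h2]; ring
    _ ≤ 4 * (D * ∑ v ∈ W, f v ^ 2) := by gcongr; exact h1 X
    _ = _ := by ring

open Matrix in
theorem dirLap_posDef {U S : Finset V} {r : ℝ}
    (hgreen : ∀ h : V → ℝ, (∀ v, v ∉ U → h v = 0) →
      ∀ z, h z ^ 2 ≤ r * energy (G.dartsIn (G.thicken U)) h) :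
    (dirLap (U \ S) (G.dartsIn (G.thicken U))).PosDef := by
  refine PosDef.of_dotProduct_mulVec_pos ?_ fun f hf => ?_
  · rw [IsHermitian, conjTranspose_eq_transpose_of_trivial]
    exact (dirLap_isMarkovForm _ _).symm
  · rw [star_trivial, dirLap_quadForm]
    obtain ⟨w, hw⟩ := Function.ne_iff.1 hf
    have h1 := hgreen (extendZero (U \ S) f) (fun v hv => extendZero_of_notMem f (by simp [hv])) w
    rw [extendZero_coe] at h1
    have hw' : f w ≠ 0 := hw
    have h2 : 0 < f w ^ 2 := by positivity
    have h3 : 0 ≤ energy (G.dartsIn (G.thicken U)) (extendZero (U \ S) f) :=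
      Finset.sum_nonneg fun _ _ => sq_nonneg _
    refine lt_of_le_of_ne h3 fun h4 => ?_
    rw [← h4] at h1
    linarith

open Matrix in
theorem pow_mul_det_le_det_nonCrossing {D : ℕ} (hdeg : ∀ x, G.degree x ≤ D) {U S K : Finset V}
    {r : ℝ} (hr : 0 < r)
    (hgreen : ∀ h : V → ℝ, (∀ v, v ∉ U → h v = 0) →
      ∀ z, h z ^ 2 ≤ r * energy (G.dartsIn (G.thicken U)) h)
    (hgood : G.IsGoodCut U S K) {q : ℝ}
    (hq : q = min (1 / 16) (1 / (16 * r)) / 2 / (4 * D + 1)) :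
    (q ^ 2) ^ (G.edgeBoundary K).card * (dirLap (U \ S) (G.dartsIn (G.thicken U))).det ≤
      (dirLap (U \ S) (G.nonCrossing U K)).det := by
  classical
  set c : ℝ := min (1 / 16) (1 / (16 * r)) with hc
  have hc0 : 0 < c := by positivity
  have hc1 : c ≤ 1 / 16 := min_le_left _ _
  set L := dirLap (U \ S) (G.nonCrossing U K)
  set L' := dirLap (U \ S) (G.dartsIn (G.thicken U)) with hL'
  set p : {x // x ∈ U \ S} → Prop :=
    fun w => ∃ e ∈ G.edgeBoundary K, (w : V) = e.1 ∨ (w : V) = e.2 with hp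
  have hpd : L'.PosDef := dirLap_posDef hgreen
  have hagree : ∀ i j, ¬ p i → ¬ p j → L i j = L' i j := by
    intro i j hi _
    simp only [L, L', dirLap, Matrix.sum_apply, vecMulVec_apply]
    refine Finset.sum_subset (nonCrossing_subset U K) fun e he he' => ?_
    obtain ⟨e', he'', h1, h2⟩ := endpoint_of_not_mem_nonCrossing he he'
    have n1 : e.1 ≠ i := fun h => hi ⟨e', he'', h ▸ h1⟩
    have n2 : e.2 ≠ i := fun h => hi ⟨e', he'', h ▸ h2⟩
    simp [incVec, n1, n2]
  have hzero : ∀ (f : {x // x ∈ U \ S} → ℝ) (v : V), v ∈ S ∨ v ∉ U →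
      extendZero (U \ S) f v = 0 := by
    intro f v hv
    refine extendZero_of_notMem f fun h => ?_
    rw [Finset.mem_sdiff] at h
    tauto
  have hcut : ∀ f : {x // x ∈ U \ S} → ℝ, (∀ i, p i → f i = 0 ∨ f i = 1) →
      (∃ i, p i ∧ f i = 1) → c ≤ f ⬝ᵥ L *ᵥ f := by
    rintro f hf ⟨i, ⟨e, he, hie⟩, hi⟩
    rw [dirLap_quadForm]
    obtain ⟨y, hxy, hy⟩ := hgood e he i hie
    refine min_le_energy_nonCrossing hr hgreen (hzero f) (fun e he x hx => ?_)
      ((extendZero_coe _ f i).trans hi) hxy hy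
    by_cases hxW : x ∈ U \ S
    · have h := hf ⟨x, hxW⟩ ⟨e, he, hx⟩
      rwa [← extendZero_coe _ f] at h
    · exact Or.inl (extendZero_of_notMem f hxW)
  have hM : ∀ f : {x // x ∈ U \ S} → ℝ, f ⬝ᵥ L' *ᵥ f ≤ (4 * D + 1) * ∑ i, f i ^ 2 := by
    intro f
    rw [dirLap_quadForm]
    have h := energy_dartsIn_le hdeg (G.thicken U) (U \ S) (extendZero (U \ S) f)
      (fun v hv => extendZero_of_notMem f hv)
    rw [← Finset.sum_coe_sort] at h
    simp only [extendZero_coe] at h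
    have h2 : 0 ≤ ∑ i, f i ^ 2 := Finset.sum_nonneg fun _ _ => sq_nonneg _
    linarith
  have hmain := pow_mul_det_le_pow_mul_det p hc0.le (dirLap_isMarkovForm _ _) hpd hagree hcut hM
  have hcard : Fintype.card {i // p i} ≤ 2 * (G.edgeBoundary K).card := by
    have h1 : Fintype.card {i // p i} ≤
        ((G.edgeBoundary K).image Prod.fst ∪ (G.edgeBoundary K).image Prod.snd).card := by
      rw [← Fintype.card_coe]
      refine Fintype.card_le_of_injective
        (fun i => ⟨(i : {x // x ∈ U \ S}), ?_⟩) ?_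
      · obtain ⟨e, he, h | h⟩ := i.2
        · exact Finset.mem_union_left _ (Finset.mem_image.2 ⟨e, he, h.symm⟩)
        · exact Finset.mem_union_right _ (Finset.mem_image.2 ⟨e, he, h.symm⟩)
      · intro i j hij
        exact Subtype.ext (Subtype.ext (Subtype.mk.inj hij))
    refine h1.trans ((Finset.card_union_le _ _).trans ?_)
    rw [two_mul]
    exact add_le_add Finset.card_image_le Finset.card_image_le
  have hM0 : (0 : ℝ) < 4 * D + 1 := by positivity
  have hq0 : 0 < q := by rw [hq]; positivity
  have hq1 : q ≤ 1 := by
    rw [hq, div_le_one hM0]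
    have : (0 : ℝ) ≤ D := by positivity
    linarith
  calc (q ^ 2) ^ (G.edgeBoundary K).card * L'.det
      = q ^ (2 * (G.edgeBoundary K).card) * L'.det := by rw [pow_mul]
    _ ≤ q ^ Fintype.card {i // p i} * L'.det :=
        mul_le_mul_of_nonneg_right (pow_le_pow_of_le_one hq0.le hq1 hcard) hpd.det_pos.le
    _ ≤ L.det := by
        rw [hq, div_pow, div_mul_eq_mul_div, div_le_iff₀ (by positivity)]
        linarith

/-- The total weight of the good cuts is at most one. -/
theorem sum_pow_card_edgeBoundary_le_one {D : ℕ} (hdeg : ∀ x, G.degree x ≤ D) {U S : Finset V}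
    {r : ℝ} (hr : 0 < r)
    (hgreen : ∀ h : V → ℝ, (∀ v, v ∉ U → h v = 0) →
      ∀ z, h z ^ 2 ≤ r * energy (G.dartsIn (G.thicken U)) h)
    (s : Finset (Finset V)) (hs : ∀ K ∈ s, S ⊆ K ∧ K ⊆ U ∧ G.IsGoodCut U S K) {q : ℝ}
    (hq : q = min (1 / 16) (1 / (16 * r)) / 2 / (4 * D + 1)) :
    ∑ K ∈ s, (q ^ 2) ^ (G.edgeBoundary K).card ≤ 1 := by
  have hpos := (dirLap_posDef (S := S) hgreen).det_pos
  have hsum : ∑ K ∈ s, (dirLap (U \ S) (G.nonCrossing U K)).det ≤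
      (dirLap (U \ S) (G.dartsIn (G.thicken U))).det := by
    refine sum_det_sum_vecMulVec_le (incVec (U \ S)) _ s (fun K => G.nonCrossing U K)
      (fun K _ => nonCrossing_subset U K) fun K hK K' hK' hne => ?_
    set g : V → ℝ := fun v => (if v ∈ K then 1 else 0) - (if v ∈ K' then 1 else 0) with hg
    have hext : extendZero (U \ S) (fun w => g w) = g := by
      funext v
      by_cases hv : v ∈ U \ S
      · simp [extendZero, hv]
      · rw [extendZero_of_notMem _ hv]
        by_cases hvS : v ∈ S
        · simp [hg, (hs K hK).1 hvS, (hs K' hK').1 hvS]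
        · have hvU : v ∉ U := fun h => hv (Finset.mem_sdiff.2 ⟨h, hvS⟩)
          have h1 : v ∉ K := fun h => hvU ((hs K hK).2.1 h)
          have h2 : v ∉ K' := fun h => hvU ((hs K' hK').2.1 h)
          simp [hg, h1, h2]
    refine ⟨fun w => g w, fun h0 => hne ?_, fun e he he' => ?_⟩
    · have hg0 : ∀ v, g v = 0 := by
        intro v
        rw [← hext, h0]
        simp [extendZero]
      ext v
      have := hg0 v
      simp only [hg] at this
      by_cases h1 : v ∈ K <;> by_cases h2 : v ∈ K' <;> simp_all
    · rw [incVec_dotProduct, hext]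
      have h1 := (mem_nonCrossing.1 he).2
      have h2 := (mem_nonCrossing.1 he').2
      simp [hg, h1, h2]
  have h := (Finset.sum_le_sum fun K hK =>
    pow_mul_det_le_det_nonCrossing hdeg hr hgreen (hs K hK).2.2 hq).trans hsum
  rw [← Finset.sum_mul] at h
  exact le_of_mul_le_mul_right (by simpa using h) hpos

end SimpleGraph

namespace SimpleGraph

theorem sum_neighborFinset_eq {V : Type*} {G : SimpleGraph V} [G.LocallyFinite]
    [DecidableRel G.Adj] {X : Finset V} {x : V}
    (f : V → ℝ) (hX : ∀ y, G.Adj x y → y ∉ X → f y = 0) :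
    ∑ y ∈ G.neighborFinset x, f y = ∑ y ∈ X, if G.Adj x y then f y else 0 := by
  rw [← Finset.sum_filter]
  refine (Finset.sum_subset (fun y hy => ?_) fun y hy hy' => ?_).symm
  · simpa using (Finset.mem_filter.1 hy).2
  · rw [mem_neighborFinset] at hy
    exact hX y hy fun h => hy' (Finset.mem_filter.2 ⟨h, hy⟩)

variable {V : Type*} [DecidableEq V] (G : SimpleGraph V) [G.LocallyFinite]

/-- One step of the simple random walk killed on leaving `U`, acting on functions. -/
noncomputable def killedStep (U : Finset V) (f : V → ℝ) (x : V) : ℝ :=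
  if x ∈ U then (G.degree x : ℝ)⁻¹ * ∑ y ∈ G.neighborFinset x, f y else 0

/-- The probability that the walk killed on leaving `U` goes from `x` to `z` in `n` steps. -/
noncomputable def killedKernel (U : Finset V) (z : V) : ℕ → V → ℝ
  | 0 => Pi.single z 1
  | n + 1 => G.killedStep U (killedKernel U z n)

/-- The inner product on functions weighted by the degree. -/
noncomputable def degInner (U : Finset V) (f g : V → ℝ) : ℝ :=
  ∑ x ∈ U, (G.degree x : ℝ) * f x * g x

variable {G}

theorem killedKernel_of_notMem {U : Finset V} {z : V} (hz : z ∈ U) (n : ℕ) {x : V} (hx : x ∉ U) :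
    G.killedKernel U z n x = 0 := by
  cases n with
  | zero =>
    have : x ≠ z := fun h => hx (h ▸ hz)
    simp [killedKernel, this]
  | succ n => simp [killedKernel, killedStep, hx]

theorem killedKernel_nonneg (U : Finset V) (z : V) (n : ℕ) (x : V) :
    0 ≤ G.killedKernel U z n x := by
  induction n generalizing x with
  | zero =>
    by_cases h : x = z
    · subst h; simp [killedKernel]
    · simp [killedKernel, h]
  | succ n ih =>
    simp only [killedKernel, killedStep]
    split_ifs
    · exact mul_nonneg (by positivity) (Finset.sum_nonneg fun y _ => ih y)
    · exact le_rfl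

theorem killedKernel_le (U : Finset V) (z : V) {p : ℕ → V → ℝ} (hp : ∀ n x, 0 ≤ p n x)
    (hp0 : p 0 z = 1)
    (hps : ∀ n x, p (n + 1) x = (G.degree x : ℝ)⁻¹ * ∑ y ∈ G.neighborFinset x, p n y)
    (n : ℕ) (x : V) : G.killedKernel U z n x ≤ p n x := by
  induction n generalizing x with
  | zero =>
    by_cases h : x = z
    · subst h; simp [killedKernel, hp0]
    · simpa [killedKernel, h] using hp 0 x
  | succ n ih =>
    simp only [killedKernel, killedStep]
    split_ifs
    · rw [hps]
      exact mul_le_mul_of_nonneg_left (Finset.sum_le_sum fun y _ => ih y) (by positivity)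
    · exact hp _ x

theorem degInner_killedStep_eq (hdeg : ∀ x, 0 < G.degree x) (U : Finset V) (f g : V → ℝ) :
    G.degInner U f (G.killedStep U g) = ∑ x ∈ U, f x * ∑ y ∈ G.neighborFinset x, g y := by
  refine Finset.sum_congr rfl fun x hx => ?_
  have : (G.degree x : ℝ) ≠ 0 := by exact_mod_cast (hdeg x).ne'
  simp only [killedStep, hx, if_true]
  field_simp

theorem degInner_killedStep_comm [DecidableRel G.Adj] (hdeg : ∀ x, 0 < G.degree x) {U : Finset V}
    {f g : V → ℝ} (hf : ∀ x, x ∉ U → f x = 0) (hg : ∀ x, x ∉ U → g x = 0) :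
    G.degInner U f (G.killedStep U g) = G.degInner U g (G.killedStep U f) := by
  rw [degInner_killedStep_eq hdeg, degInner_killedStep_eq hdeg]
  have key : ∀ f g : V → ℝ, (∀ x, x ∉ U → g x = 0) →
      ∑ x ∈ U, f x * ∑ y ∈ G.neighborFinset x, g y =
        ∑ x ∈ U, ∑ y ∈ U, f x * if G.Adj x y then g y else 0 := fun f g hg =>
    Finset.sum_congr rfl fun x _ => by
      rw [sum_neighborFinset_eq (X := U) g fun y _ hy => hg y hy, Finset.mul_sum]
  rw [key f g hg, key g f hf]
  rw [Finset.sum_comm]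
  refine Finset.sum_congr rfl fun x _ => Finset.sum_congr rfl fun y _ => ?_
  simp only [G.adj_comm x y]
  split_ifs
  · ring
  · simp

theorem degInner_killedKernel [DecidableRel G.Adj] (hdeg : ∀ x, 0 < G.degree x) {U : Finset V}
    {z : V} (hz : z ∈ U) (i j : ℕ) :
    G.degInner U (G.killedKernel U z i) (G.killedKernel U z j) =
      G.degree z * G.killedKernel U z (i + j) z := by
  induction i generalizing j with
  | zero =>
    rw [degInner, Finset.sum_eq_single z]
    · simp [killedKernel]
    · intro x _ hx
      simp [killedKernel, hx]
    · exact fun h => absurd hz h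
  | succ i ih =>
    have h1 : G.degInner U (G.killedKernel U z (i + 1)) (G.killedKernel U z j) =
        G.degInner U (G.killedKernel U z j) (G.killedStep U (G.killedKernel U z i)) := by
      simp only [degInner, killedKernel]
      exact Finset.sum_congr rfl fun x _ => by ring
    rw [h1, degInner_killedStep_comm hdeg (fun x => killedKernel_of_notMem hz j)
      (fun x => killedKernel_of_notMem hz i)]
    have h2 := ih (j + 1)
    rw [killedKernel] at h2
    rw [h2]
    congr 2
    omega

/-- Discrete Green formula. -/
theorem sum_dartsIn_mul [DecidableRel G.Adj] (hdeg : ∀ x, 0 < G.degree x) {U : Finset V}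
    {h : V → ℝ} (hh : ∀ x, x ∉ U → h x = 0) (g : V → ℝ) :
    ∑ e ∈ G.dartsIn (G.thicken U), (h e.1 - h e.2) * (g e.1 - g e.2) =
      2 * (G.degInner U h g - G.degInner U h (G.killedStep U g)) := by
  have hswap : ∑ e ∈ G.dartsIn (G.thicken U), h e.2 * (g e.2 - g e.1) =
      ∑ e ∈ G.dartsIn (G.thicken U), h e.1 * (g e.1 - g e.2) := by
    refine Finset.sum_nbij' Prod.swap Prod.swap ?_ ?_ ?_ ?_ ?_
    · intro e he
      rw [mem_dartsIn] at he ⊢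
      exact ⟨he.2.1, he.1, he.2.2.symm⟩
    · intro e he
      rw [mem_dartsIn] at he ⊢
      exact ⟨he.2.1, he.1, he.2.2.symm⟩
    all_goals simp
  have h1 : ∑ e ∈ G.dartsIn (G.thicken U), h e.1 * (g e.1 - g e.2) =
      ∑ x ∈ U, h x * ∑ y ∈ G.neighborFinset x, (g x - g y) := by
    rw [dartsIn, Finset.sum_filter, Finset.sum_product]
    refine (Finset.sum_subset (fun x hx => mem_thicken.2 (Or.inl hx)) fun x _ hx => ?_).symm.trans
      (Finset.sum_congr rfl fun x hx => ?_)
    · simp [hh x hx]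
    · rw [sum_neighborFinset_eq (X := G.thicken U), Finset.mul_sum]
      · refine Finset.sum_congr rfl fun y _ => ?_
        split_ifs <;> simp
      · exact fun y hy hy' => absurd (mem_thicken.2 (Or.inr ⟨x, hx, hy⟩)) hy'
  have h2 : ∑ e ∈ G.dartsIn (G.thicken U), (h e.1 - h e.2) * (g e.1 - g e.2) =
      ∑ e ∈ G.dartsIn (G.thicken U), h e.1 * (g e.1 - g e.2) +
        ∑ e ∈ G.dartsIn (G.thicken U), h e.2 * (g e.2 - g e.1) := by
    rw [← Finset.sum_add_distrib]
    exact Finset.sum_congr rfl fun e _ => by ring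
  rw [h2, hswap, h1, degInner_killedStep_eq hdeg, degInner, ← Finset.sum_sub_distrib, ← two_mul]
  congr 1
  refine Finset.sum_congr rfl fun x _ => ?_
  rw [Finset.sum_sub_distrib]
  simp only [Finset.sum_const, card_neighborFinset_eq_degree, nsmul_eq_mul]
  ring

theorem tendsto_killedKernel [DecidableRel G.Adj] (hdeg : ∀ x, 0 < G.degree x) {U : Finset V}
    {z : V} (hz : z ∈ U) {C : ℝ} (hC : ∀ N, ∑ n ∈ Finset.range N, G.killedKernel U z n z ≤ C)
    {x : V} (hx : x ∈ U) :
    Filter.Tendsto (fun N => G.killedKernel U z N x) Filter.atTop (nhds 0) := by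
  have hsum : Summable fun n => G.killedKernel U z n z :=
    summable_of_sum_range_le (fun n => killedKernel_nonneg U z n z) hC
  have h2 : Filter.Tendsto (fun N : ℕ => G.killedKernel U z (N + N) z) Filter.atTop (nhds 0) :=
    hsum.tendsto_atTop_zero.comp
      (Filter.tendsto_atTop_mono (fun n => Nat.le_add_left n n) Filter.tendsto_id)
  have h3 : Filter.Tendsto (fun N : ℕ => √(G.degree z * G.killedKernel U z (N + N) z))
      Filter.atTop (nhds 0) := by
    have := (h2.const_mul (G.degree z : ℝ)).sqrt
    simpa using this
  refine squeeze_zero (fun N => killedKernel_nonneg U z N x) (fun N => ?_) h3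
  refine Real.le_sqrt_of_sq_le ?_
  rw [← degInner_killedKernel hdeg hz]
  have h4 : (1 : ℝ) ≤ G.degree x := by exact_mod_cast hdeg x
  calc G.killedKernel U z N x ^ 2
      ≤ G.degree x * G.killedKernel U z N x * G.killedKernel U z N x := by
        nlinarith [sq_nonneg (G.killedKernel U z N x)]
    _ ≤ _ := Finset.single_le_sum
        (f := fun x => (G.degree x : ℝ) * G.killedKernel U z N x * G.killedKernel U z N x)
        (fun y _ => mul_nonneg (mul_nonneg (by positivity) (killedKernel_nonneg U z N y))
          (killedKernel_nonneg U z N y)) hx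

/-- A bound on the Green function of the killed walk bounds pointwise values by the energy. -/
theorem sq_le_mul_energy [DecidableRel G.Adj] (hdeg : ∀ x, 0 < G.degree x) {U : Finset V} {C : ℝ}
    (hC0 : 0 < C) {z : V} (hC : ∀ N, ∑ n ∈ Finset.range N, G.killedKernel U z n z ≤ C)
    {h : V → ℝ} (hh : ∀ v, v ∉ U → h v = 0) :
    h z ^ 2 ≤ C * energy (G.dartsIn (G.thicken U)) h := by
  have hEn : 0 ≤ energy (G.dartsIn (G.thicken U)) h := Finset.sum_nonneg fun _ _ => sq_nonneg _
  by_cases hz : z ∈ U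
  swap
  · rw [hh z hz]
    simpa using mul_nonneg hC0.le hEn
  set E := energy (G.dartsIn (G.thicken U)) h with hE
  set q := G.killedKernel U z with hq
  set π : ℝ := ((G.degree z : ℕ) : ℝ) with hπ
  have hπ1 : 1 ≤ π := by rw [hπ]; exact_mod_cast hdeg z
  set g : ℕ → V → ℝ := fun N x => ∑ n ∈ Finset.range N, q n x with hg
  have hgU : ∀ N x, x ∉ U → g N x = 0 := fun N x hx =>
    Finset.sum_eq_zero fun n _ => killedKernel_of_notMem hz n hx
  have hstep : ∀ N x, x ∈ U → g N x - G.killedStep U (g N) x = q 0 x - q N x := by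
    intro N x hx
    have : G.killedStep U (g N) x = ∑ n ∈ Finset.range N, q (n + 1) x := by
      simp only [hq, killedKernel, killedStep, hx, if_true, hg]
      rw [Finset.sum_comm, Finset.mul_sum]
    rw [this, ← Finset.sum_sub_distrib, Finset.sum_range_sub']
  have hD : ∀ N (f : V → ℝ), (∀ x, x ∉ U → f x = 0) →
      ∑ e ∈ G.dartsIn (G.thicken U), (f e.1 - f e.2) * (g N e.1 - g N e.2) =
        2 * (π * f z - G.degInner U f (q N)) := by
    intro N f hf
    rw [sum_dartsIn_mul hdeg hf]
    congr 1
    have h1 : π * f z = G.degInner U f (q 0) := by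
      rw [degInner, Finset.sum_eq_single z]
      · simp [hq, killedKernel, hπ]
      · intro x _ hx
        simp [hq, killedKernel, hx]
      · exact fun h => absurd hz h
    rw [h1]
    simp only [degInner, ← Finset.sum_sub_distrib]
    refine Finset.sum_congr rfl fun x hx => ?_
    rw [← mul_sub, hstep N x hx, mul_sub]
  have hineq : ∀ (t : ℝ) (N : ℕ),
      4 * t * π * h z - 2 * t ^ 2 * (π * C) ≤ E + 4 * t * G.degInner U h (q N) := by
    intro t N
    have h0 : 0 ≤ ∑ e ∈ G.dartsIn (G.thicken U),
        ((h e.1 - h e.2) - t * (g N e.1 - g N e.2)) ^ 2 :=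
      Finset.sum_nonneg fun _ _ => sq_nonneg _
    have h1 : ∑ e ∈ G.dartsIn (G.thicken U),
        ((h e.1 - h e.2) - t * (g N e.1 - g N e.2)) ^ 2 =
        E - 2 * t * ∑ e ∈ G.dartsIn (G.thicken U), (h e.1 - h e.2) * (g N e.1 - g N e.2) +
          t ^ 2 * ∑ e ∈ G.dartsIn (G.thicken U),
            (g N e.1 - g N e.2) * (g N e.1 - g N e.2) := by
      rw [hE, energy, Finset.mul_sum, Finset.mul_sum, ← Finset.sum_sub_distrib,
        ← Finset.sum_add_distrib]
      exact Finset.sum_congr rfl fun e _ => by ring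
    rw [h1, hD N h hh, hD N (g N) (hgU N)] at h0
    have h2 : 0 ≤ G.degInner U (g N) (q N) :=
      Finset.sum_nonneg fun x _ => mul_nonneg (mul_nonneg (by positivity)
        (Finset.sum_nonneg fun n _ => killedKernel_nonneg U z n x)) (killedKernel_nonneg U z N x)
    have h3 : π * g N z ≤ π * C := mul_le_mul_of_nonneg_left (hC N) (by linarith)
    have h4 : t ^ 2 * (2 * (π * g N z - G.degInner U (g N) (q N))) ≤ t ^ 2 * (2 * (π * C)) :=
      mul_le_mul_of_nonneg_left (by linarith) (sq_nonneg t)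
    linarith
  have hlim : Filter.Tendsto (fun N => G.degInner U h (q N)) Filter.atTop (nhds 0) := by
    have : Filter.Tendsto (fun N => ∑ x ∈ U, (G.degree x : ℝ) * h x * q N x) Filter.atTop
        (nhds (∑ x ∈ U, (G.degree x : ℝ) * h x * 0)) :=
      tendsto_finsetSum _ fun x hx => (tendsto_killedKernel hdeg hz hC hx).const_mul _
    simpa [degInner] using this
  have hfinal : ∀ t : ℝ, 4 * t * π * h z - 2 * t ^ 2 * (π * C) ≤ E := by
    intro t
    have := ge_of_tendsto' ((hlim.const_mul (4 * t)).const_add E) (hineq t)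
    simpa using this
  have h5 := hfinal (h z / C)
  have h6 : 4 * (h z / C) * π * h z - 2 * (h z / C) ^ 2 * (π * C) = 2 * π * (h z ^ 2 / C) := by
    field_simp
    ring
  rw [h6] at h5
  have h7 : 0 ≤ h z ^ 2 / C := by positivity
  have h8 : h z ^ 2 / C ≤ E := by nlinarith
  rwa [div_le_iff₀ hC0, mul_comm] at h8

end SimpleGraph

namespace SimpleGraph

section Exhaustion

variable {V : Type*} [DecidableEq V] {G : SimpleGraph V} [G.LocallyFinite]

theorem subset_thicken (U : Finset V) : U ⊆ G.thicken U := Finset.subset_union_left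

theorem monotone_iterate_thicken (S : Finset V) : Monotone fun n => G.thicken^[n] S :=
  monotone_nat_of_le_succ fun n => by
    rw [Function.iterate_succ_apply']
    exact subset_thicken _

theorem Preconnected.exists_mem_iterate_thicken (hG : G.Preconnected) {S : Finset V} {x : V}
    (hx : x ∈ S) (y : V) : ∃ n, y ∈ G.thicken^[n] S := by
  have h := (reachable_iff_reflTransGen x y).1 (hG x y)
  induction h with
  | refl => exact ⟨0, hx⟩
  | tail _ hab ih =>
    obtain ⟨n, hn⟩ := ih
    refine ⟨n + 1, ?_⟩
    rw [Function.iterate_succ_apply']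
    exact mem_thicken.2 (Or.inr ⟨_, hn, hab⟩)

theorem Connected.countable (hG : G.Connected) : Countable V := by
  obtain ⟨x⟩ := hG.nonempty
  have : (Set.univ : Set V) = ⋃ n, (G.thicken^[n] {x} : Set V) := by
    refine (Set.eq_univ_of_forall fun y => ?_).symm
    simpa using hG.preconnected.exists_mem_iterate_thicken (Finset.mem_singleton_self x) y
  rw [← Set.countable_univ_iff, this]
  exact Set.countable_iUnion fun n => Finset.countable_toSet _

end Exhaustion

section Walk

variable {V : Type*} [MeasurableSpace V]

/-- The probability of never visiting `S`. -/
noncomputable def avoidProb (P : V → Measure (ℕ → V)) (S : Finset V) (y : V) : ℝ :=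
  (P y {ω | ∀ k, ω k ∉ S}).toReal

theorem measurableSet_forall_notMem [DiscreteMeasurableSpace V] (S : Finset V) :
    MeasurableSet {ω : ℕ → V | ∀ k, ω k ∉ S} := by
  have h : {ω : ℕ → V | ∀ k, ω k ∉ S} = ⋂ k, (fun ω : ℕ → V => ω k) ⁻¹' {v | v ∉ S} := by
    ext; simp
  rw [h]
  exact MeasurableSet.iInter fun k => measurable_pi_apply k (MeasurableSet.of_discrete)

theorem measurableSet_eval_eq [DiscreteMeasurableSpace V] (n : ℕ) (z : V) :
    MeasurableSet {ω : ℕ → V | ω n = z} := by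
  have h : Measurable fun ω : ℕ → V => ω n := measurable_pi_apply n
  exact h (measurableSet_singleton z)

theorem measurableSet_cylinder_nat [DiscreteMeasurableSpace V] (n : ℕ) (γ : ℕ → V) :
    MeasurableSet {ω : ℕ → V | ∀ k ≤ n, ω k = γ k} := by
  have h : {ω : ℕ → V | ∀ k ≤ n, ω k = γ k} =
      ⋂ k, ⋂ _ : k ≤ n, (fun ω : ℕ → V => ω k) ⁻¹' {γ k} := by
    ext; simp
  rw [h]
  exact MeasurableSet.iInter fun k => MeasurableSet.iInter fun _ =>
    measurable_pi_apply k (MeasurableSet.of_discrete)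

theorem measure_ext_of_cylinders [DiscreteMeasurableSpace V] [Countable V]
    {μ ν : Measure (ℕ → V)} [IsFiniteMeasure μ] (huniv : μ Set.univ = ν Set.univ)
    (h : ∀ (n : ℕ) (γ : ℕ → V),
      μ {ω | ∀ k ≤ n, ω k = γ k} = ν {ω | ∀ k ≤ n, ω k = γ k}) : μ = ν := by
  refine ext_of_generate_finite
    {A : Set (ℕ → V) | ∃ (n : ℕ) (γ : ℕ → V), A = {ω | ∀ k ≤ n, ω k = γ k}} ?_ ?_ ?_ huniv
  · refine le_antisymm ?_ ?_
    · refine iSup_le fun k => ?_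
      rw [MeasurableSpace.comap_le_iff_le_map]
      intro A _
      change MeasurableSet[MeasurableSpace.generateFrom _] ((fun ω : ℕ → V => ω k) ⁻¹' A)
      have hA : (fun ω : ℕ → V => ω k) ⁻¹' A =
          ⋃ l : {l : Fin (k + 1) → V // l (Fin.last k) ∈ A},
            {ω | ∀ j ≤ k, ω j = if h : j < k + 1 then l.1 ⟨j, h⟩ else ω 0} := by
        ext ω
        simp only [Set.mem_preimage, Set.mem_iUnion, Set.mem_ofPred_eq]
        constructor
        · intro hω
          exact ⟨⟨fun j => ω j, hω⟩, fun j hj => by rw [dif_pos (Nat.lt_succ_of_le hj)]⟩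
        · rintro ⟨⟨l, hl⟩, hω⟩
          have := hω k le_rfl
          simp only [Nat.lt_succ_self, dif_pos] at this
          rw [this]
          exact hl
      rw [hA]
      refine MeasurableSet.iUnion fun l => MeasurableSpace.measurableSet_generateFrom ?_
      refine ⟨k, fun j => if h : j < k + 1 then l.1 ⟨j, h⟩ else l.1 (Fin.last k), ?_⟩
      ext ω
      simp only [Set.mem_ofPred_eq]
      refine forall₂_congr fun j hj => ?_
      rw [dif_pos (Nat.lt_succ_of_le hj), dif_pos (Nat.lt_succ_of_le hj)]
    · refine MeasurableSpace.generateFrom_le ?_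
      rintro A ⟨n, γ, rfl⟩
      exact measurableSet_cylinder_nat n γ
  · rintro _ ⟨n, γ, rfl⟩ _ ⟨m, γ', rfl⟩ ⟨ω₀, h₀, h₀'⟩
    refine ⟨max n m, ω₀, ?_⟩
    ext ω
    simp only [Set.mem_inter_iff, Set.mem_ofPred_eq] at h₀ h₀' ⊢
    constructor
    · rintro ⟨h1, h2⟩ k hk
      rcases le_max_iff.1 hk with hk | hk
      · rw [h1 k hk, h₀ k hk]
      · rw [h2 k hk, h₀' k hk]
    · intro h1
      exact ⟨fun k hk => by rw [h1 k (le_max_of_le_left hk), h₀ k hk],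
        fun k hk => by rw [h1 k (le_max_of_le_right hk), h₀' k hk]⟩
  · rintro _ ⟨n, γ, rfl⟩
    exact h n γ

/-- The measures `P x` are the laws of the simple random walks on `G` started from `x`. -/
def IsSimpleRandomWalk [DecidableEq V] (G : SimpleGraph V) [G.LocallyFinite] [DecidableRel G.Adj]
    (P : V → Measure (ℕ → V)) : Prop :=
  ∀ (x : V) (n : ℕ) (γ : ℕ → V), P x {ω | ∀ k ≤ n, ω k = γ k} =
    (if γ 0 = x then 1 else 0) * ∏ k ∈ Finset.range n,
      (if G.Adj (γ k) (γ (k + 1)) then (G.degree (γ k) : ENNReal)⁻¹ else 0)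

variable [DecidableEq V] {G : SimpleGraph V} [G.LocallyFinite] [DecidableRel G.Adj]
  {P : V → Measure (ℕ → V)}

namespace IsSimpleRandomWalk

theorem measure_start (hP : G.IsSimpleRandomWalk P) (x : V) : P x {ω | ω 0 = x} = 1 := by
  simpa using hP x 0 fun _ => x

theorem ae_start [DiscreteMeasurableSpace V] [∀ x, IsProbabilityMeasure (P x)]
    (hP : G.IsSimpleRandomWalk P) (x : V) : ∀ᵐ ω ∂P x, ω 0 = x :=
  (mem_ae_iff_prob_eq_one (measurableSet_eval_eq 0 x)).2 (hP.measure_start x)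

theorem degree_pos [∀ x, IsProbabilityMeasure (P x)] (hP : G.IsSimpleRandomWalk P)
    (hG : G.Connected) (x : V) : 0 < G.degree x := by
  rcases subsingleton_or_nontrivial V with hV | hV
  · exfalso
    have h := hP x 1 fun _ => x
    have h1 : {ω : ℕ → V | ∀ k ≤ 1, ω k = x} = Set.univ :=
      Set.eq_univ_of_forall fun ω k _ => Subsingleton.elim _ _
    rw [h1, measure_univ] at h
    simp at h
  · exact hG.preconnected.degree_pos_of_nontrivial x

theorem avoidProb_of_mem [DiscreteMeasurableSpace V] [∀ x, IsProbabilityMeasure (P x)]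
    (hP : G.IsSimpleRandomWalk P) {S : Finset V} {x : V} (hx : x ∈ S) :
    avoidProb P S x = 0 := by
  have : P x {ω | ∀ k, ω k ∉ S} = 0 := by
    rw [measure_eq_zero_iff_ae_notMem]
    filter_upwards [hP.ae_start x] with ω hω h
    exact h 0 (hω ▸ hx)
  simp [avoidProb, this]

variable [DiscreteMeasurableSpace V] [Countable V] [∀ x, IsProbabilityMeasure (P x)]

theorem map_shift (hP : G.IsSimpleRandomWalk P) {x : V} (hx : 0 < G.degree x) :
    (P x).map (fun ω k => ω (k + 1)) =
      ∑ y ∈ G.neighborFinset x, (G.degree x : ENNReal)⁻¹ • P y := by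
  have hmeas : Measurable fun (ω : ℕ → V) k => ω (k + 1) :=
    measurable_pi_lambda _ fun k => measurable_pi_apply (k + 1)
  have hprob : IsProbabilityMeasure ((P x).map fun ω k => ω (k + 1)) :=
    Measure.isProbabilityMeasure_map hmeas.aemeasurable
  refine measure_ext_of_cylinders ?_ fun n γ => ?_
  · rw [measure_univ, Measure.finsetSum_apply]
    simp only [Measure.smul_apply, measure_univ, smul_eq_mul, mul_one, Finset.sum_const,
      card_neighborFinset_eq_degree, nsmul_eq_mul]
    rw [ENNReal.mul_inv_cancel] <;> simp [hx.ne']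
  · rw [Measure.map_apply hmeas (measurableSet_cylinder_nat n γ), Measure.finsetSum_apply]
    obtain ⟨γ', h0, hs⟩ : ∃ γ' : ℕ → V, γ' 0 = x ∧ ∀ k, γ' (k + 1) = γ k :=
      ⟨fun k => Nat.casesOn k x γ, rfl, fun _ => rfl⟩
    have h1 : P x ((fun ω k => ω (k + 1)) ⁻¹' {ω : ℕ → V | ∀ k ≤ n, ω k = γ k}) =
        P x {ω | ∀ k ≤ n + 1, ω k = γ' k} := by
      refine measure_congr ?_
      filter_upwards [hP.ae_start x] with ω hω
      refine propext ⟨fun h k hk => ?_, fun h k hk => (h (k + 1) (by omega)).trans (hs k)⟩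
      cases k with
      | zero => exact hω.trans h0.symm
      | succ k => exact (h k (by omega)).trans (hs k).symm
    rw [h1, hP, Finset.prod_range_succ']
    have hd : ∀ v w, v = w → G.degree v = G.degree w := by
      rintro _ _ rfl
      rfl
    simp only [h0, hs, hd _ _ h0, hd _ _ (hs _), if_true, one_mul, Measure.smul_apply, smul_eq_mul, hP _ n γ]
    by_cases h : G.Adj x (γ 0)
    · rw [Finset.sum_eq_single (γ 0)]
      · simp [h, mul_comm]
      · intro y _ hy
        simp [hy.symm]
      · intro h'
        exact absurd ((mem_neighborFinset _ _ _).2 h) h'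
    · rw [if_neg h, mul_zero]
      refine (Finset.sum_eq_zero fun y hy => ?_).symm
      have : γ 0 ≠ y := by
        rintro rfl
        exact h ((mem_neighborFinset _ _ _).1 hy)
      simp [this]

/-- The Markov property at time one. -/
theorem toReal_shift (hP : G.IsSimpleRandomWalk P) {x : V} (hx : 0 < G.degree x)
    {A : Set (ℕ → V)} (hA : MeasurableSet A) :
    (P x {ω | (fun k => ω (k + 1)) ∈ A}).toReal =
      (G.degree x : ℝ)⁻¹ * ∑ y ∈ G.neighborFinset x, (P y A).toReal := by
  have hmeas : Measurable fun (ω : ℕ → V) k => ω (k + 1) :=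
    measurable_pi_lambda _ fun k => measurable_pi_apply (k + 1)
  have h := congrArg (fun ν => (ν A).toReal) (hP.map_shift hx)
  simp only [Measure.map_apply hmeas hA, Measure.finsetSum_apply, Measure.smul_apply,
    smul_eq_mul] at h
  rw [ENNReal.toReal_sum] at h
  · simp only [ENNReal.toReal_mul, ENNReal.toReal_inv, ENNReal.toReal_natCast] at h
    rw [Finset.mul_sum]
    exact h
  · intro y _
    exact ENNReal.mul_ne_top (by simp [hx.ne']) (measure_ne_top _ _)

/-- A summable on-diagonal heat kernel bounds the killed Green function. -/
theorem sum_killedKernel_le (hP : G.IsSimpleRandomWalk P) (hdeg : ∀ x, 0 < G.degree x)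
    (U : Finset V) (z : V) (N : ℕ) :
    ∑ n ∈ Finset.range N, G.killedKernel U z n z ≤
      ∑ n ∈ Finset.range N, (P z {ω | ω n = z}).toReal := by
  refine Finset.sum_le_sum fun n _ => ?_
  refine killedKernel_le U z (p := fun n x => (P x {ω | ω n = z}).toReal)
    (fun _ _ => ENNReal.toReal_nonneg) ?_ (fun n x => ?_) n z
  · simp [hP.measure_start]
  · exact hP.toReal_shift (hdeg x) (A := {ω | ω n = z})
      (measurableSet_eval_eq n z)

theorem degree_mul_escape (hP : G.IsSimpleRandomWalk P) {x : V} (hx : 0 < G.degree x)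
    (S : Finset V) : (G.degree x : ℝ) * (P x {ω | ∀ k : ℕ, 1 ≤ k → ω k ∉ S}).toReal =
      ∑ y ∈ G.neighborFinset x, avoidProb P S y := by
  have h : {ω : ℕ → V | ∀ k : ℕ, 1 ≤ k → ω k ∉ S} =
      {ω | (fun k => ω (k + 1)) ∈ {ω : ℕ → V | ∀ k, ω k ∉ S}} := by
    ext ω
    refine ⟨fun h k => h (k + 1) (by omega), fun h k hk => ?_⟩
    obtain ⟨k, rfl⟩ := Nat.exists_eq_add_of_le' hk
    exact h k
  rw [h, hP.toReal_shift hx (measurableSet_forall_notMem S), ← mul_assoc, mul_inv_cancel₀,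
    one_mul]
  · rfl
  · exact_mod_cast hx.ne'

theorem degree_mul_avoidProb (hP : G.IsSimpleRandomWalk P) {x : V} (hx : 0 < G.degree x)
    {S : Finset V} (hxS : x ∉ S) :
    (G.degree x : ℝ) * avoidProb P S x = ∑ y ∈ G.neighborFinset x, avoidProb P S y := by
  rw [← hP.degree_mul_escape hx, avoidProb]
  congr 2
  refine measure_congr ?_
  filter_upwards [hP.ae_start x] with ω hω
  refine propext ⟨fun h k _ => h k, fun h k => ?_⟩
  rcases Nat.eq_zero_or_pos k with rfl | hk
  · rwa [hω]
  · exact h k hk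

/-- The capacity of `S` is at most the number of edges of any cut surrounding `S`. -/
theorem capacity_le_card_edgeBoundary (hP : G.IsSimpleRandomWalk P) (hdeg : ∀ x, 0 < G.degree x)
    {S K : Finset V} (hSK : S ⊆ K) :
    ∑ x ∈ S, (G.degree x : ℝ) * (P x {ω | ∀ k : ℕ, 1 ≤ k → ω k ∉ S}).toReal ≤
      (G.edgeBoundary K).card := by
  set u := avoidProb P S with hu
  have h1 : ∑ x ∈ S, (G.degree x : ℝ) * (P x {ω | ∀ k : ℕ, 1 ≤ k → ω k ∉ S}).toReal =
      ∑ x ∈ K, ∑ y ∈ G.neighborFinset x, (u y - u x) := by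
    refine (Finset.sum_congr rfl fun x hx => ?_).trans (Finset.sum_subset hSK fun x _ hx => ?_)
    · rw [hP.degree_mul_escape (hdeg x)]
      exact Finset.sum_congr rfl fun y _ => by rw [hu, hP.avoidProb_of_mem hx, sub_zero]
    · rw [Finset.sum_sub_distrib, ← hP.degree_mul_avoidProb (hdeg x) hx]
      simp [hu]
  have h2 : ∑ x ∈ K, ∑ y ∈ G.neighborFinset x, (u y - u x) =
      ∑ x ∈ K, ∑ y ∈ G.thicken K, if G.Adj x y then u y - u x else 0 :=
    Finset.sum_congr rfl fun x hx => sum_neighborFinset_eq _ fun y hy hy' =>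
      absurd (mem_thicken.2 (Or.inr ⟨x, hx, hy⟩)) hy'
  have h3 : ∑ x ∈ K, ∑ y ∈ K, (if G.Adj x y then u y - u x else 0) = 0 := by
    have h4 : ∑ x ∈ K, ∑ y ∈ K, (if G.Adj x y then u y - u x else 0) =
        -∑ x ∈ K, ∑ y ∈ K, (if G.Adj x y then u y - u x else 0) := by
      conv_lhs => rw [Finset.sum_comm]
      rw [← Finset.sum_neg_distrib]
      refine Finset.sum_congr rfl fun x _ => ?_
      rw [← Finset.sum_neg_distrib]
      refine Finset.sum_congr rfl fun y _ => ?_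
      simp only [G.adj_comm y x]
      split_ifs <;> ring
    linarith
  have h5 : ∑ x ∈ K, ∑ y ∈ G.thicken K, (if G.Adj x y then u y - u x else 0) =
      ∑ e ∈ G.edgeBoundary K, (u e.2 - u e.1) := by
    have h6 : ∀ x, ∑ y ∈ K, (if G.Adj x y then u y - u x else 0) =
        ∑ y ∈ G.thicken K, if y ∈ K then (if G.Adj x y then u y - u x else 0) else 0 := fun x => by
      rw [Finset.sum_ite_mem, Finset.inter_eq_right.2 (subset_thicken K)]
    rw [← sub_eq_zero, edgeBoundary, Finset.sum_filter, Finset.sum_product,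
      ← Finset.sum_sub_distrib]
    refine Eq.trans ?_ h3
    refine Finset.sum_congr rfl fun x _ => ?_
    rw [h6, ← Finset.sum_sub_distrib]
    refine Finset.sum_congr rfl fun y _ => ?_
    by_cases h : y ∈ K <;> simp [h]
  rw [h1, h2, h5, Finset.card_eq_sum_ones, Nat.cast_sum]
  refine Finset.sum_le_sum fun e _ => ?_
  have hle : u e.2 ≤ 1 := by
    rw [hu, avoidProb]
    exact ENNReal.toReal_le_of_le_ofReal zero_le_one (by simpa using prob_le_one)
  have hge : 0 ≤ u e.1 := ENNReal.toReal_nonneg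
  push_cast
  linarith

end IsSimpleRandomWalk

end Walk

end SimpleGraph

namespace SimpleGraph

section OpenGraph

variable {V : Type*} {G : SimpleGraph V}

variable (G) in
/-- The subgraph of open edges. -/
def openGraph (ω : Sym2 V → Bool) : SimpleGraph V :=
  fromEdgeSet {e | e ∈ G.edgeSet ∧ ω e = true}

theorem openGraph_adj {ω : Sym2 V → Bool} {x y : V} :
    (G.openGraph ω).Adj x y ↔ G.Adj x y ∧ ω s(x, y) = true := by
  simp only [openGraph, fromEdgeSet_adj, Set.mem_ofPred_eq, mem_edgeSet]
  exact ⟨fun h => h.1, fun h => ⟨h, h.1.ne⟩⟩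

theorem openGraph_le (ω : Sym2 V → Bool) : G.openGraph ω ≤ G :=
  fun _ _ h => (openGraph_adj.1 h).1

end OpenGraph

variable {V : Type*} [DecidableEq V] {G : SimpleGraph V} [G.LocallyFinite] [DecidableRel G.Adj]

/-- If the clusters of `S` in a subgraph `H` stay in `U`, they are enclosed by a good cut none of
whose edges lies in `H`. -/
theorem exists_isGoodCut {H : SimpleGraph V} (hH : H ≤ G) {U S : Finset V}
    (hU : ∀ x ∈ S, ∀ y, H.Reachable x y → y ∈ U) :
    ∃ K, (S ⊆ K ∧ K ⊆ U ∧ G.IsGoodCut U S K) ∧ ∀ e ∈ G.edgeBoundary K, ¬ H.Adj e.1 e.2 := by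
  classical
  set C : Set V := {v | ∃ x ∈ S, H.Reachable x v} with hC
  set R : V → V → Prop := fun a b => G.Adj a b ∧ a ∉ C ∧ b ∉ C with hR
  set K : Finset V := U.filter fun v => ¬ ∃ y, y ∉ U ∧ Relation.ReflTransGen R v y with hK
  have hCU : ∀ v ∈ C, v ∈ U := fun v ⟨x, hx, hv⟩ => hU x hx v hv
  have hCK : ∀ v ∈ C, v ∈ K := by
    intro v hv
    refine Finset.mem_filter.2 ⟨hCU v hv, ?_⟩
    rintro ⟨y, hy, hvy⟩
    rcases hvy.cases_head with rfl | ⟨w, hw, _⟩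
    · exact hy (hCU v hv)
    · exact hw.2.1 hv
  have hSC : ∀ x ∈ S, x ∈ C := fun x hx => ⟨x, hx, Reachable.refl x⟩
  have hout : ∀ v, v ∉ K → ∃ y, y ∉ U ∧ Relation.ReflTransGen R v y := by
    intro v hv
    by_contra h
    by_cases hvU : v ∈ U
    · exact hv (Finset.mem_filter.2 ⟨hvU, h⟩)
    · exact h ⟨v, hvU, Relation.ReflTransGen.refl⟩
  have hnot : ∀ v y, y ∉ U → Relation.ReflTransGen R v y → v ∉ K :=
    fun v y hy hvy hv => (Finset.mem_filter.1 hv).2 ⟨y, hy, hvy⟩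
  have hedge : ∀ e ∈ G.edgeBoundary K, e.1 ∈ C ∧ e.2 ∉ C := by
    intro e he
    obtain ⟨h1, h2, h3⟩ := mem_edgeBoundary.1 he
    have h4 : e.2 ∉ C := fun h => h2 (hCK _ h)
    refine ⟨?_, h4⟩
    by_contra h5
    obtain ⟨y, hy, hvy⟩ := hout _ h2
    exact hnot _ y hy (hvy.head ⟨h3, h5, h4⟩) h1
  refine ⟨K, ⟨fun x hx => hCK x (hSC x hx), Finset.filter_subset _ _, ?_⟩, ?_⟩
  · rintro e he x (rfl | rfl)
    · obtain ⟨s, hs, hse⟩ := (hedge e he).1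
      refine ⟨s, ?_, Or.inl hs⟩
      have h := (reachable_iff_reflTransGen _ _).1 hse.symm
      have hback : ∀ v, Relation.ReflTransGen H.Adj v s →
          Relation.ReflTransGen (fun a b => G.Adj a b ∧ (a ∈ K ↔ b ∈ K)) v s := by
        intro v hv
        induction hv using Relation.ReflTransGen.head_induction_on with
        | refl => exact Relation.ReflTransGen.refl
        | @head a b hab hbs ih =>
          have hb : b ∈ C := ⟨s, hs, ((reachable_iff_reflTransGen _ _).2 hbs).symm⟩
          have ha : a ∈ C :=
            ⟨s, hs, (hab.reachable.trans ((reachable_iff_reflTransGen _ _).2 hbs)).symm⟩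
          exact ih.head ⟨hH hab, iff_of_true (hCK a ha) (hCK b hb)⟩
      exact hback _ h
    · obtain ⟨y, hy, hvy⟩ := hout _ (mem_edgeBoundary.1 he).2.1
      refine ⟨y, ?_, Or.inr hy⟩
      generalize e.2 = b at hvy
      induction hvy using Relation.ReflTransGen.head_induction_on with
      | refl => exact Relation.ReflTransGen.refl
      | @head a b hab hbs ih =>
        exact ih.head ⟨hab.1, iff_of_false (hnot _ y hy (hbs.head hab)) (hnot _ y hy hbs)⟩
  · intro e he hadj
    obtain ⟨⟨s, hs, hse⟩, h2⟩ := hedge e he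
    exact h2 ⟨s, hs, hse.trans hadj.reachable⟩

theorem Connected.edgeBoundary_nonempty [Infinite V] (hG : G.Connected) {K : Finset V}
    (hK : K.Nonempty) : (G.edgeBoundary K).Nonempty := by
  obtain ⟨x, hx⟩ := hK
  obtain ⟨y, hy⟩ := Infinite.exists_notMem_finset K
  by_contra hne
  refine hy ?_
  have h := (reachable_iff_reflTransGen x y).1 (hG.preconnected x y)
  clear hy
  induction h with
  | refl => exact hx
  | tail _ hab ih =>
    by_contra hb
    exact hne ⟨(_, _), mem_edgeBoundary.2 ⟨ih, hb, hab⟩⟩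

section Percolation

/-- The cylinder probabilities of `μ` are those of Bernoulli bond percolation. -/
def IsBernoulli (p : ℝ) (μ : Measure (Sym2 V → Bool)) : Prop :=
  ∀ (F : Finset (Sym2 V)) (σ : Sym2 V → Bool),
    μ {ω | ∀ e ∈ F, ω e = σ e} = ∏ e ∈ F, ENNReal.ofReal (if σ e then p else 1 - p)

variable {μ : Measure (Sym2 V → Bool)} {p : ℝ}

theorem measure_edgeBoundary_closed (hμ : IsBernoulli p μ) (K : Finset V) :
    μ {ω | ∀ e ∈ G.edgeBoundary K, ω s(e.1, e.2) = false} =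
      ENNReal.ofReal (1 - p) ^ (G.edgeBoundary K).card := by
  have h := hμ ((G.edgeBoundary K).image fun e => s(e.1, e.2)) fun _ => false
  rw [Finset.prod_image] at h
  · simpa only [Finset.forall_mem_image, Bool.false_eq_true, if_false, Finset.prod_const] using h
  · rintro ⟨a, b⟩ he ⟨a', b'⟩ he' hee
    have h1 := mem_edgeBoundary.1 he
    have h2 := mem_edgeBoundary.1 he'
    rcases Sym2.eq_iff.1 hee with ⟨rfl, rfl⟩ | ⟨rfl, rfl⟩
    · rfl
    · exact absurd h1.1 h2.2.1

/-- The Peierls bound in finite volume. -/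
theorem measure_reachable_subset_le (hμ : IsBernoulli p μ) {q m : ℝ}
    (hp : 1 - p = q ^ 2 * Real.exp (-(1 / 2))) {U S : Finset V}
    (hsum : ∀ s : Finset (Finset V), (∀ K ∈ s, S ⊆ K ∧ K ⊆ U ∧ G.IsGoodCut U S K) →
      ∑ K ∈ s, (q ^ 2) ^ (G.edgeBoundary K).card ≤ 1)
    (hm : ∀ K, S ⊆ K → m ≤ (G.edgeBoundary K).card) :
    μ {ω | ∀ x ∈ S, ∀ y, (G.openGraph ω).Reachable x y → y ∈ U} ≤
      ENNReal.ofReal (Real.exp (-(1 / 2) * m)) := by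
  classical
  set s : Finset (Finset V) := U.powerset.filter fun K => S ⊆ K ∧ K ⊆ U ∧ G.IsGoodCut U S K
  have hs : ∀ K ∈ s, S ⊆ K ∧ K ⊆ U ∧ G.IsGoodCut U S K := fun K hK => (Finset.mem_filter.1 hK).2
  have hsub : {ω | ∀ x ∈ S, ∀ y, (G.openGraph ω).Reachable x y → y ∈ U} ⊆
      ⋃ K ∈ s, {ω | ∀ e ∈ G.edgeBoundary K, ω s(e.1, e.2) = false} := by
    intro ω hω
    obtain ⟨K, hK, hcl⟩ := exists_isGoodCut (openGraph_le (G := G) ω) hω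
    refine Set.mem_biUnion (Finset.mem_filter.2 ⟨Finset.mem_powerset.2 hK.2.1, hK⟩) fun e he => ?_
    by_contra h
    exact hcl e he (openGraph_adj.2 ⟨(mem_edgeBoundary.1 he).2.2, by simpa using h⟩)
  have hp0 : 0 ≤ 1 - p := by rw [hp]; positivity
  calc _ ≤ ∑ K ∈ s, μ {ω | ∀ e ∈ G.edgeBoundary K, ω s(e.1, e.2) = false} :=
        (measure_mono hsub).trans (measure_biUnion_finset_le _ _)
    _ = ENNReal.ofReal (∑ K ∈ s, (1 - p) ^ (G.edgeBoundary K).card) := by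
        rw [ENNReal.ofReal_sum_of_nonneg fun K _ => pow_nonneg hp0 _]
        refine Finset.sum_congr rfl fun K _ => ?_
        rw [measure_edgeBoundary_closed hμ, ENNReal.ofReal_pow hp0]
    _ ≤ ENNReal.ofReal (Real.exp (-(1 / 2) * m)) := by
        refine ENNReal.ofReal_le_ofReal ?_
        calc ∑ K ∈ s, (1 - p) ^ (G.edgeBoundary K).card
            ≤ ∑ K ∈ s, (q ^ 2) ^ (G.edgeBoundary K).card * Real.exp (-(1 / 2) * m) := by
              refine Finset.sum_le_sum fun K hK => ?_
              rw [hp, mul_pow, ← Real.exp_nat_mul]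
              refine mul_le_mul_of_nonneg_left (Real.exp_le_exp.2 ?_) (by positivity)
              linarith [hm K (hs K hK).1]
          _ ≤ Real.exp (-(1 / 2) * m) := by
              rw [← Finset.sum_mul]
              exact mul_le_of_le_one_left (Real.exp_nonneg _) (hsum s hs)

theorem measure_not_infinite_le (hμ : IsBernoulli p μ) (hG : G.Connected) {q m : ℝ}
    (hp : 1 - p = q ^ 2 * Real.exp (-(1 / 2))) {S : Finset V} (hS : S.Nonempty)
    (hsum : ∀ (U : Finset V) (s : Finset (Finset V)),
      (∀ K ∈ s, S ⊆ K ∧ K ⊆ U ∧ G.IsGoodCut U S K) →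
      ∑ K ∈ s, (q ^ 2) ^ (G.edgeBoundary K).card ≤ 1)
    (hm : ∀ K, S ⊆ K → m ≤ (G.edgeBoundary K).card) :
    μ {ω | ¬ ∃ x ∈ S, {y | (G.openGraph ω).Reachable x y}.Infinite} ≤
      ENNReal.ofReal (Real.exp (-(1 / 2) * m)) := by
  obtain ⟨x₀, hx₀⟩ := hS
  set E : ℕ → Set (Sym2 V → Bool) := fun N =>
    {ω | ∀ x ∈ S, ∀ y, (G.openGraph ω).Reachable x y → y ∈ G.thicken^[N] S} with hE
  have hmono : Monotone E := fun M N hMN ω hω x hx y hy =>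
    monotone_iterate_thicken S hMN (hω x hx y hy)
  have hsub : {ω | ¬ ∃ x ∈ S, {y | (G.openGraph ω).Reachable x y}.Infinite} ⊆ ⋃ N, E N := by
    intro ω hω
    have hfin : (⋃ x ∈ S, {y | (G.openGraph ω).Reachable x y}).Finite :=
      S.finite_toSet.biUnion fun x hx => by
        by_contra h
        exact hω ⟨x, hx, h⟩
    choose f hf using hG.preconnected.exists_mem_iterate_thicken hx₀
    obtain ⟨N, hN⟩ := (hfin.image f).bddAbove
    refine Set.mem_iUnion.2 ⟨N, fun x hx y hy => ?_⟩
    exact monotone_iterate_thicken S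
      (hN (Set.mem_image_of_mem f (Set.mem_biUnion (Finset.mem_coe.2 hx) hy))) (hf y)
  refine (measure_mono hsub).trans ?_
  rw [hmono.measure_iUnion]
  exact iSup_le fun N => measure_reachable_subset_le hμ hp (hsum _) hm

end Percolation

theorem infinite_of_sq_le_mul_energy [Nonempty V] {r : ℝ}
    (h : ∀ (U : Finset V) (h : V → ℝ), (∀ v, v ∉ U → h v = 0) →
      ∀ z, h z ^ 2 ≤ r * energy (G.dartsIn (G.thicken U)) h) : Infinite V := by
  by_contra hV
  rw [not_infinite_iff_finite] at hV
  have := Fintype.ofFinite V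
  have h1 := h Finset.univ (fun _ => 1) (fun v hv => absurd (Finset.mem_univ v) hv)
    (Classical.arbitrary V)
  norm_num [energy] at h1

section HeatKernel

variable [MeasurableSpace V] [MeasurableSingletonClass V] {P : V → Measure (ℕ → V)}
  [∀ x, IsProbabilityMeasure (P x)]

/-- On-diagonal heat kernel decay bounds pointwise values of finitely supported functions by
their energy. -/
theorem IsSimpleRandomWalk.exists_sq_le_mul_energy (hP : G.IsSimpleRandomWalk P)
    (hG : G.Connected) {c d : ℝ} (hc : 0 < c) (hd : 2 < d)
    (hheat : ∀ (x : V) (n : ℕ), 1 ≤ n →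
      (P x {ω | ω n = x}).toReal ≤ c / (n : ℝ) ^ (d / 2)) :
    ∃ r : ℝ, 0 < r ∧ ∀ (U : Finset V) (h : V → ℝ), (∀ v, v ∉ U → h v = 0) →
      ∀ z, h z ^ 2 ≤ r * energy (G.dartsIn (G.thicken U)) h := by
  have := hG.countable
  have hdeg := hP.degree_pos hG
  have hsum : Summable fun n : ℕ => c / (n : ℝ) ^ (d / 2) := by
    simpa [div_eq_mul_inv] using
      (Real.summable_nat_rpow_inv.2 (show 1 < d / 2 by linarith)).mul_left c
  have hnn : ∀ n : ℕ, 0 ≤ c / (n : ℝ) ^ (d / 2) := fun n => by positivity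
  have hr : 0 < 1 + ∑' n : ℕ, c / (n : ℝ) ^ (d / 2) := by
    have : 0 ≤ ∑' n : ℕ, c / (n : ℝ) ^ (d / 2) := tsum_nonneg hnn
    linarith
  refine ⟨_, hr, fun U h hh z => sq_le_mul_energy hdeg hr (fun N => ?_) hh⟩
  refine (hP.sum_killedKernel_le hdeg U z N).trans ?_
  have hle : ∀ n : ℕ, (P z {ω | ω n = z}).toReal ≤
      (if n = 0 then 1 else 0) + c / (n : ℝ) ^ (d / 2) := by
    intro n
    rcases Nat.eq_zero_or_pos n with rfl | hn
    · have : (P z {ω | ω 0 = z}).toReal = 1 := by rw [hP.measure_start]; simp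
      rw [this, if_pos rfl]
      linarith [hnn 0]
    · rw [if_neg hn.ne', zero_add]
      exact hheat z n hn
  refine (Finset.sum_le_sum fun n _ => hle n).trans ?_
  rw [Finset.sum_add_distrib]
  refine add_le_add ?_ (hsum.sum_le_tsum _ fun n _ => hnn n)
  rw [Finset.sum_ite_eq']
  split_ifs <;> norm_num

end HeatKernel

end SimpleGraph

/-- **Theorem 1.1.** Let `G` be a connected bounded-degree graph whose simple random
walk heat kernel satisfies `p_n(x,x) ≤ c n^{−d/2}` for some `d > 4` (the walk laws
`P x` are characterized by their cylinder probabilities). Then there exists `p < 1`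
such that for every Bernoulli bond percolation measure `μ` with parameter `p`
(characterized by its cylinder probabilities) and every finite `S ⊂ V`,
`μ(S ↮ ∞) ≤ exp(−cap(S)/2)`, where
`cap(S) = Σ_{x∈S} d(x)·P_x[X_k ∉ S ∀ k ≥ 1]`. In particular every vertex lies in
an infinite open cluster with positive probability, so `p_c(G) < 1`. -/
theorem statement19 {V : Type*} [DecidableEq V] [MeasurableSpace V]
    [MeasurableSingletonClass V]
    (G : SimpleGraph V) [G.LocallyFinite] [DecidableRel G.Adj]
    (hconn : G.Connected) (D : ℕ) (hdeg : ∀ x : V, G.degree x ≤ D)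
    (P : V → Measure (ℕ → V)) [∀ x, IsProbabilityMeasure (P x)]
    (hP : ∀ (x : V) (n : ℕ) (γ : ℕ → V),
      P x {ω | ∀ k ≤ n, ω k = γ k} =
        (if γ 0 = x then 1 else 0) *
          ∏ k ∈ Finset.range n,
            (if G.Adj (γ k) (γ (k + 1)) then (G.degree (γ k) : ENNReal)⁻¹ else 0))
    (c d : ℝ) (hc : 0 < c) (hd : 4 < d)
    (hheat : ∀ (x : V) (n : ℕ), 1 ≤ n →
      (P x {ω | ω n = x}).toReal ≤ c / (n : ℝ) ^ (d / 2)) :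
    ∃ p : ℝ, 0 ≤ p ∧ p < 1 ∧
      ∀ μ : Measure (Sym2 V → Bool), IsProbabilityMeasure μ →
        (∀ (F : Finset (Sym2 V)) (σ : Sym2 V → Bool),
          μ {ω | ∀ e ∈ F, ω e = σ e} =
            ∏ e ∈ F, ENNReal.ofReal (if σ e then p else 1 - p)) →
        (∀ S : Finset V,
          μ {ω | ¬ ∃ x ∈ S,
              {y : V | (SimpleGraph.fromEdgeSet
                {e : Sym2 V | e ∈ G.edgeSet ∧ ω e = true}).Reachable x y}.Infinite} ≤
            ENNReal.ofReal (Real.exp (-(1 / 2) * ∑ x ∈ S,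
              (G.degree x : ℝ) *
                (P x {ω | ∀ k : ℕ, 1 ≤ k → ω k ∉ (S : Set V)}).toReal))) ∧
        ∀ x : V,
          0 < μ {ω | {y : V | (SimpleGraph.fromEdgeSet
              {e : Sym2 V | e ∈ G.edgeSet ∧ ω e = true}).Reachable x y}.Infinite} := by
  have hRW : G.IsSimpleRandomWalk P := hP
  have := hconn.countable
  have := hconn.nonempty
  have hpos := hRW.degree_pos hconn
  obtain ⟨r, hr, hgreen⟩ := hRW.exists_sq_le_mul_energy hconn hc (by linarith) hheat
  have := SimpleGraph.infinite_of_sq_le_mul_energy hgreen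
  obtain ⟨q, hq⟩ : ∃ q : ℝ, q = min (1 / 16) (1 / (16 * r)) / 2 / (4 * D + 1) := ⟨_, rfl⟩
  have hsum : ∀ (S U : Finset V) (s : Finset (Finset V)),
      (∀ K ∈ s, S ⊆ K ∧ K ⊆ U ∧ G.IsGoodCut U S K) →
      ∑ K ∈ s, (q ^ 2) ^ (G.edgeBoundary K).card ≤ 1 := fun S U s hs =>
    SimpleGraph.sum_pow_card_edgeBoundary_le_one hdeg hr (hgreen U) s hs hq
  have hq0 : 0 < q := by rw [hq]; positivity
  have hq1 : q ≤ 1 := by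
    rw [hq]
    refine div_le_one_of_le₀ ?_ (by positivity)
    have h1 : min (1 / 16) (1 / (16 * r)) ≤ 1 / 16 := min_le_left _ _
    have h2 : (0 : ℝ) ≤ D := by positivity
    linarith
  have hexp : Real.exp (-(1 / 2)) < 1 := Real.exp_lt_one_iff.2 (by norm_num)
  refine ⟨1 - q ^ 2 * Real.exp (-(1 / 2)), ?_, ?_, fun μ hμ hB => ?_⟩
  · have : q ^ 2 * Real.exp (-(1 / 2)) ≤ 1 :=
      mul_le_one₀ (pow_le_one₀ hq0.le hq1) (Real.exp_nonneg _) hexp.le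
    linarith
  · have : 0 < q ^ 2 * Real.exp (-(1 / 2)) := by positivity
    linarith
  · refine ⟨fun S => ?_, fun x => ?_⟩
    · rcases S.eq_empty_or_nonempty with rfl | hS
      · simp
      · exact SimpleGraph.measure_not_infinite_le hB hconn (sub_sub_cancel _ _) hS (hsum S)
          fun K hK => hRW.capacity_le_card_edgeBoundary hpos hK
    · have h1 := SimpleGraph.measure_not_infinite_le (m := 1) hB hconn (sub_sub_cancel _ _)
        (Finset.singleton_nonempty x) (hsum {x}) fun K hK => by
          have := (hconn.edgeBoundary_nonempty ⟨x, hK (Finset.mem_singleton_self x)⟩).card_pos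
          exact_mod_cast this
      rw [pos_iff_ne_zero]
      intro h0
      have h2 : μ {ω | ¬ ∃ x' ∈ ({x} : Finset V),
          {y | (G.openGraph ω).Reachable x' y}.Infinite} < 1 :=
        h1.trans_lt (by rw [mul_one]; exact ENNReal.ofReal_lt_one.2 hexp)
      refine h2.ne ((prob_compl_eq_one_iff₀ (NullMeasurableSet.of_null h0)).2 h0 ▸ ?_)
      congr 1
      ext ω
      simp [SimpleGraph.openGraph]
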